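/- arXiv:2209.01147 — 2 statements merged into one kernel-verified Lean document; each statement's English description precedes it below -/
import Mathlib

section
/- For every integer d ≥ 2 there exists a constant C = C(d) such that for every set X of n ≥ 2 points in ℝ^d there exists a perfect matching of X whose crossing number with respect to every Euclidean ball in ℝ^d is at most ( 6(d+1)² + 24e(d+2) / ((1−1/d)²·ln 2) )·n^{1−1/d} + C·ln(dn)·ln n. -/
open Finset
open scoped Classical

/-- A perfect matching of `X`: a partition of `X` into disjoint edges (2-element sets),
plus at most one loop (a 1-element set, allowed when `|X|` is odd). -/
def IsPerfectMatching {V : Type*} [DecidableEq V] (X : Finset V) (M : Finset (Finset V)) : Prop :=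
  (∀ e ∈ M, e.card = 2 ∨ e.card = 1) ∧
  (M : Set (Finset V)).PairwiseDisjoint id ∧
  M.biUnion id = X ∧
  (M.filter fun e => e.card = 1).card ≤ 1

/-- The number of edges of `M` crossed by a region `B` (an edge is crossed when it has one
endpoint inside `B` and one endpoint outside `B`). -/
noncomputable def regionCrossCount {V : Type*} (M : Finset (Finset V)) (B : Set V) : ℕ :=
  (M.filter fun e => (∃ x ∈ e, x ∈ B) ∧ ∃ y ∈ e, y ∉ B).card


lemma vc_lemma {d : ℕ} {κ : Type*} (u : κ → EuclideanSpace ℝ (Fin d)) (e : κ → ℝ) (T : Finset κ)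
    (h : ∀ S ⊆ T, ∃ (y : EuclideanSpace ℝ (Fin d)) (t : ℝ), ∀ i ∈ T,
      (i ∈ S ↔ e i + t - 2 * inner ℝ (u i) y ≤ 0)) : T.card ≤ d + 1 := by
  by_contra hT
  push Not at hT
  let v : T → ℝ × EuclideanSpace ℝ (Fin d) := fun i => (1, u i)
  have hdep : ¬ LinearIndependent ℝ v := by
    intro hv
    have := hv.fintype_card_le_finrank
    simp at this
    omega
  rw [Fintype.not_linearIndependent_iff] at hdep
  obtain ⟨g, hg, i0, hi0⟩ := hdep
  have h1 : ∑ i, g i = 0 := by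
    have := congrArg Prod.fst hg
    simpa [v, Prod.fst_sum] using this
  have h2 : ∑ i, g i • u i = 0 := by
    have := congrArg Prod.snd hg
    simpa [v, Prod.snd_sum] using this
  -- key
  have key : ∀ g : T → ℝ, ∑ i, g i = 0 → ∑ i, g i • u i = 0 → g ≠ 0 →
      0 ≤ ∑ i, g i * e i → False := by
    intro g h1 h2 hne hs
    obtain ⟨y, t, hy⟩ := h (T.filter fun i => ∃ hi : i ∈ T, 0 < g ⟨i, hi⟩) (filter_subset _ _)
    have hval : ∑ i, g i * (e i + t - 2 * inner ℝ (u i) y) = ∑ i, g i * e i := by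
      have h3 : ∑ i : T, g i * inner ℝ (u i) y = 0 := by
        have := congrArg (fun z => inner ℝ z y) h2
        simpa [sum_inner, inner_smul_left] using this
      calc ∑ i, g i * (e i + t - 2 * inner ℝ (u i) y)
          = ∑ i, g i * e i + (∑ i, g i) * t - 2 * ∑ i : T, g i * inner ℝ (u i) y := by
            rw [sum_mul, mul_sum, ← sum_add_distrib, ← sum_sub_distrib]
            exact sum_congr rfl fun i _ => by ring
        _ = _ := by rw [h1, h3]; ring
    have hneg : ∃ i, g i < 0 := by
      by_contra hcon
      push Not at hcon
      apply hne
      funext i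
      exact (sum_eq_zero_iff_of_nonneg (fun i _ => hcon i)).1 h1 i (mem_univ i)
    obtain ⟨i1, hi1⟩ := hneg
    have : ∑ i, g i * (e i + t - 2 * inner ℝ (u i) y) < 0 := by
      refine sum_neg' ?_ ⟨i1, mem_univ _, ?_⟩
      · intro i _
        have := hy i i.2
        by_cases hp : 0 < g i
        · have h4 := this.1 (by simp [hp])
          nlinarith
        · have h4 : ¬ _ := fun hh => hp (by simpa using this.2 hh)
          push Not at h4 hp
          nlinarith
      · have := hy i1 i1.2
        have h4 : ¬ _ := fun hh => absurd hi1 (not_lt.2 (le_of_lt (by simpa using this.2 hh)))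
        push Not at h4
        nlinarith
    linarith
  rcases le_total 0 (∑ i, g i * e i) with hs | hs
  · exact key g h1 h2 (fun h => hi0 (by simp [h])) hs
  · refine key (fun i => - g i) (by rw [sum_neg_distrib, h1, neg_zero])
      (by simp_rw [neg_smul]; rw [sum_neg_distrib, h2, neg_zero]) (fun h => hi0 ?_) (by simpa using hs)
    have := congrFun h i0
    simpa using this

section edge
variable {α : Type*} [Fintype α]

lemma edge_density : ∀ (S : Finset α) (𝒜 : Finset (Finset α)) (k : ℕ), (∀ A ∈ 𝒜, A ⊆ S) →
    (∀ T, 𝒜.Shatters T → T.card ≤ k) →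
    ∑ j, (𝒜.nonMemberSubfamily j ∩ 𝒜.memberSubfamily j).card ≤ k * 𝒜.card := by
  intro S
  induction S using Finset.induction_on with
  | empty =>
    intro 𝒜 k hS _
    rw [sum_eq_zero]
    · simp
    intro j _
    rw [card_eq_zero, eq_empty_iff_forall_notMem]
    intro A hA
    simp only [mem_inter, mem_memberSubfamily] at hA
    have := hS _ hA.2.1
    simp at this
  | insert a S ha ih =>
    intro 𝒜 k hS hk
    set N := 𝒜.nonMemberSubfamily a with hN
    set M := 𝒜.memberSubfamily a with hM
    have hsub : ∀ A ∈ N ∪ M, A ⊆ S := by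
      intro A hA x hx
      simp only [hN, hM, mem_union, mem_memberSubfamily, mem_nonMemberSubfamily] at hA
      rcases hA with hA | hA
      · have := hS _ hA.1 hx
        rcases mem_insert.1 this with rfl | h
        · exact absurd hx hA.2
        · exact h
      · have := hS _ hA.1 (mem_insert_of_mem hx)
        rcases mem_insert.1 this with rfl | h
        · exact absurd hx hA.2
        · exact h
    have hcard : N.card + M.card = 𝒜.card := by
      rw [add_comm]; exact card_memberSubfamily_add_card_nonMemberSubfamily a 𝒜
    have hU := ih (N ∪ M) k hsub (by
      intro T hT
      apply hk
      have haT : a ∉ T := by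
        obtain ⟨A, hA, hTA⟩ := hT (Subset.refl T)
        intro hh
        have : a ∈ A := by
          have : a ∈ T ∩ A := by rw [hTA]; exact hh
          exact (mem_inter.1 this).2
        exact ha (hsub A hA this)
      intro t ht
      obtain ⟨A, hA, hTA⟩ := hT ht
      simp only [hN, hM, mem_union, mem_memberSubfamily, mem_nonMemberSubfamily] at hA
      rcases hA with hA | hA
      · exact ⟨A, hA.1, hTA⟩
      · refine ⟨insert a A, hA.1, ?_⟩
        rw [inter_insert_of_notMem haT, hTA])
    have hI : ∑ j, ((N ∩ M).nonMemberSubfamily j ∩ (N ∩ M).memberSubfamily j).card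
        + (N ∩ M).card ≤ k * (N ∩ M).card := by
      have hs : ∀ T, (N ∩ M).Shatters T → T.card + 1 ≤ k := by
        intro T hT
        have haT : a ∉ T := by
          obtain ⟨A, hA, hTA⟩ := hT (Subset.refl T)
          intro hh
          have : a ∈ A := by
            have : a ∈ T ∩ A := by rw [hTA]; exact hh
            exact (mem_inter.1 this).2
          exact ha (hsub A (mem_union_left _ (mem_inter.1 hA).1) this)
        rw [← card_insert_of_notMem haT]
        apply hk
        intro t ht
        obtain ⟨A, hA, hTA⟩ := hT (t := t.erase a) (by
          intro x hx
          have := ht (mem_of_mem_erase hx)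
          rcases mem_insert.1 this with rfl | h
          · simp at hx
          · exact h)
        simp only [hN, hM, mem_inter, mem_memberSubfamily, mem_nonMemberSubfamily] at hA
        by_cases hat : a ∈ t
        · refine ⟨insert a A, hA.2.1, ?_⟩
          rw [← insert_inter_distrib, hTA, insert_erase hat]
        · refine ⟨A, hA.1.1, ?_⟩
          rw [insert_inter_of_notMem hA.1.2, hTA, erase_eq_of_notMem hat]
      rcases (N ∩ M).eq_empty_or_nonempty with h0 | ⟨A, hA⟩
      · rw [h0]; simp [memberSubfamily]
      · have hk1 : 1 ≤ k := by
          have := hs ∅ (by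
            intro t ht
            exact ⟨A, hA, by rw [subset_empty.1 ht]; simp⟩)
          simpa using this
        have := ih (N ∩ M) (k - 1)
          (fun A hA => hsub A (mem_union_left _ (mem_inter.1 hA).1))
          (fun T hT => by have := hs T hT; omega)
        obtain ⟨k', rfl⟩ : ∃ k', k = k' + 1 := ⟨k - 1, by omega⟩
        simp only [Nat.add_sub_cancel] at this
        linarith [add_mul k' 1 (N ∩ M).card]
    have hstep : ∑ j, (𝒜.nonMemberSubfamily j ∩ 𝒜.memberSubfamily j).card ≤
        ∑ j, (((N ∪ M).nonMemberSubfamily j ∩ (N ∪ M).memberSubfamily j).card +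
          ((N ∩ M).nonMemberSubfamily j ∩ (N ∩ M).memberSubfamily j).card +
            (if j = a then (N ∩ M).card else 0)) := by
      apply sum_le_sum
      intro j _
      by_cases hj : j = a
      · subst hj
        simp [← hN, ← hM]
      · simp only [hj, if_false, add_zero]
        set Y := 𝒜.nonMemberSubfamily j ∩ 𝒜.memberSubfamily j with hY
        have e1 := card_memberSubfamily_add_card_nonMemberSubfamily a Y
        rw [← e1, ← card_union_add_card_inter]
        have hj' : a ≠ j := fun h => hj h.symm
        apply add_le_add
        · apply card_le_card
          intro A
          simp only [hY, hN, hM, mem_union, mem_inter, mem_memberSubfamily, mem_nonMemberSubfamily,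
            mem_insert]
          rw [insert_comm]
          grind
        · apply card_le_card
          intro A
          simp only [hY, hN, hM, mem_union, mem_inter, mem_memberSubfamily, mem_nonMemberSubfamily,
            mem_insert]
          rw [insert_comm]
          grind
    rw [sum_add_distrib, sum_add_distrib] at hstep
    simp only [sum_ite_eq', mem_univ, if_true] at hstep
    have e2 := card_union_add_card_inter N M
    calc _ ≤ _ := hstep
      _ ≤ k * (N ∪ M).card + k * (N ∩ M).card := by omega
      _ = k * 𝒜.card := by rw [← mul_add, e2, hcard]

lemma edge_weight (W : Finset α → ℕ) (k : ℕ)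
    (hk : ∀ T, (univ.filter fun A => 0 < W A).Shatters T → T.card ≤ k) :
    ∑ j, ∑ A ∈ univ.filter (fun A => j ∉ A), min (W A) (W (insert j A)) ≤ k * ∑ A, W A := by
  set N := ∑ A, W A with hN
  have hWN : ∀ A, W A ≤ N := fun A => single_le_sum (f := W) (fun _ _ => Nat.zero_le _) (mem_univ A)
  have hlayer : ∀ x ≤ N, x = ∑ t ∈ range N, if t < x then 1 else 0 := by
    intro x hx
    rw [← sum_filter, sum_const, smul_eq_mul, mul_one]
    have : (range N).filter (fun t => t < x) = range x := by
      ext t; simp; omega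
    rw [this, card_range]
  let F : ℕ → Finset (Finset α) := fun t => univ.filter fun A => t < W A
  have h1 : ∑ j, ∑ A ∈ univ.filter (fun A => j ∉ A), min (W A) (W (insert j A)) =
      ∑ t ∈ range N, ∑ j, ((F t).nonMemberSubfamily j ∩ (F t).memberSubfamily j).card := by
    rw [sum_comm]
    apply sum_congr rfl
    intro j _
    have : ∀ A ∈ univ.filter (fun A : Finset α => j ∉ A), min (W A) (W (insert j A)) =
        ∑ t ∈ range N, if t < min (W A) (W (insert j A)) then 1 else 0 := fun A _ =>
      hlayer _ ((min_le_left _ _).trans (hWN A))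
    rw [sum_congr rfl this, sum_comm]
    apply sum_congr rfl
    intro t _
    rw [← sum_filter, sum_const, smul_eq_mul, mul_one, filter_filter]
    congr 1
    ext A
    simp [F]
    tauto
  have h2 : N = ∑ t ∈ range N, (F t).card := by
    conv_lhs => rw [hN]
    rw [sum_congr rfl (fun A _ => hlayer (W A) (hWN A)), sum_comm]
    apply sum_congr rfl
    intro t _
    rw [← sum_filter, sum_const, smul_eq_mul, mul_one]
  rw [h1]
  conv_rhs => rw [h2, mul_sum]
  apply sum_le_sum
  intro t _
  apply edge_density univ (F t) k (fun A _ => subset_univ A)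
  intro T hT
  apply hk
  apply hT.mono_left
  intro A
  simp [F]
  omega
end edge

lemma sum_update {κ ι : Type*} [Fintype κ] [Fintype ι] (j : κ) (G : (κ → ι) → ℝ) :
    ∑ a : κ → ι, ∑ i : ι, G (Function.update a j i) = Fintype.card ι * ∑ a, G a := by
  let e : ((κ → ι) × ι) ≃ ((κ → ι) × ι) :=
    { toFun := fun p => (Function.update p.1 j p.2, p.1 j)
      invFun := fun p => (Function.update p.1 j p.2, p.1 j)
      left_inv := fun p => by simp
      right_inv := fun p => by simp }
  have h1 : ∑ a : κ → ι, ∑ i : ι, G (Function.update a j i) = ∑ p : (κ → ι) × ι, G (e p).1 := by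
    rw [Fintype.sum_prod_type]; rfl
  rw [h1, e.sum_comp (fun p => G p.1), Fintype.sum_prod_type]
  simp [mul_sum]

section haussler
variable {V κ ι : Type*} [Fintype κ] [Fintype ι]

noncomputable def trc (R : V → ι → Prop) (a : κ → ι) (x : V) : Finset κ :=
  univ.filter fun j => R x (a j)

lemma split_bound (R : V → ι → Prop) (Y : Finset V) (δ : ℝ)
    (hδ : ∀ x ∈ Y, ∀ y ∈ Y, x ≠ y → δ ≤ ((univ.filter fun i => ¬ (R x i ↔ R y i)).card : ℝ))
    (hY : Y.Nonempty) :
    δ / 2 * ((Y.card : ℝ) - 1) ≤ ∑ i, ((min (Y.filter fun x => ¬ R x i).card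
      (Y.filter fun x => R x i).card : ℕ) : ℝ) := by
  have hn : (0 : ℝ) < Y.card := by exact_mod_cast hY.card_pos
  have h1 : ∀ i, ((Y.filter fun x => R x i).card : ℝ) * (Y.filter fun x => ¬ R x i).card ≤
      ((min (Y.filter fun x => ¬ R x i).card (Y.filter fun x => R x i).card : ℕ) : ℝ) * Y.card := by
    intro i
    have := card_filter_add_card_filter_not (s := Y) (fun x => R x i)
    have h2 : (Y.card : ℝ) = ((Y.filter fun x => R x i).card : ℝ) +
      (Y.filter fun x => ¬ R x i).card := by exact_mod_cast this.symm
    rw [h2]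
    push_cast
    have p1 : (0:ℝ) ≤ (Y.filter fun x => R x i).card := by positivity
    have p2 : (0:ℝ) ≤ (Y.filter fun x => ¬ R x i).card := by positivity
    rcases min_choice ((Y.filter fun x => ¬ R x i).card : ℝ) ((Y.filter fun x => R x i).card : ℝ)
      with h | h <;> rw [h] <;> nlinarith
  have h3 : ∑ i, ((Y.filter fun x => R x i).card : ℝ) * (Y.filter fun x => ¬ R x i).card =
      ∑ x ∈ Y, ∑ y ∈ Y, ((univ.filter fun i => R x i ∧ ¬ R y i).card : ℝ) := by
    have : ∀ i, ((Y.filter fun x => R x i).card : ℝ) * (Y.filter fun x => ¬ R x i).card =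
        ∑ x ∈ Y, ∑ y ∈ Y, if R x i ∧ ¬ R y i then (1:ℝ) else 0 := by
      intro i
      rw [card_filter, card_filter]
      push_cast
      rw [sum_mul_sum]
      refine sum_congr rfl fun x _ => sum_congr rfl fun y _ => ?_
      by_cases h1 : R x i <;> by_cases h2 : R y i <;> simp [h1, h2]
    rw [sum_congr rfl fun i _ => this i, sum_comm]
    refine sum_congr rfl fun x _ => ?_
    rw [sum_comm]
    refine sum_congr rfl fun y _ => ?_
    rw [card_filter]
    push_cast
    rfl
  have h4 : ∑ x ∈ Y, ∑ y ∈ Y, ((univ.filter fun i => R x i ∧ ¬ R y i).card : ℝ) =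
      (∑ x ∈ Y, ∑ y ∈ Y, ((univ.filter fun i => ¬ (R x i ↔ R y i)).card : ℝ)) / 2 := by
    have hs : ∑ x ∈ Y, ∑ y ∈ Y, ((univ.filter fun i => R x i ∧ ¬ R y i).card : ℝ) =
      ∑ x ∈ Y, ∑ y ∈ Y, ((univ.filter fun i => R y i ∧ ¬ R x i).card : ℝ) := sum_comm
    have hs2 : ∑ x ∈ Y, ∑ y ∈ Y, ((univ.filter fun i => ¬ (R x i ↔ R y i)).card : ℝ) =
      ∑ x ∈ Y, ∑ y ∈ Y, ((univ.filter fun i => R x i ∧ ¬ R y i).card : ℝ) +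
      ∑ x ∈ Y, ∑ y ∈ Y, ((univ.filter fun i => R y i ∧ ¬ R x i).card : ℝ) := by
      rw [← sum_add_distrib]
      refine sum_congr rfl fun x _ => ?_
      rw [← sum_add_distrib]
      refine sum_congr rfl fun y _ => ?_
      rw [← Nat.cast_add, ← card_union_of_disjoint]
      · congr 2
        ext i
        simp
        tauto
      · rw [disjoint_left]
        intro i
        simp
        tauto
    rw [hs2, ← hs]; ring
  have h5 : (Y.card : ℝ) * ((Y.card - 1) * δ) ≤
      ∑ x ∈ Y, ∑ y ∈ Y, ((univ.filter fun i => ¬ (R x i ↔ R y i)).card : ℝ) := by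
    rw [← nsmul_eq_mul, ← sum_const]
    apply sum_le_sum
    intro x hx
    rw [← add_sum_erase _ _ hx]
    have : (Y.card - 1 : ℝ) * δ = ∑ y ∈ Y.erase x, δ := by
      rw [sum_const, card_erase_of_mem hx, nsmul_eq_mul, Nat.cast_sub hY.card_pos]
      simp
    rw [this]
    have h6 : ∑ y ∈ Y.erase x, δ ≤
        ∑ y ∈ Y.erase x, ((univ.filter fun i => ¬ (R x i ↔ R y i)).card : ℝ) :=
      sum_le_sum fun y hy => hδ x hx y (mem_of_mem_erase hy) (ne_of_mem_erase hy).symm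
    have : (0:ℝ) ≤ ((univ.filter fun i => ¬ (R x i ↔ R x i)).card : ℝ) := by positivity
    linarith
  have h6 := sum_le_sum fun i (_ : i ∈ (univ : Finset ι)) => h1 i
  rw [h3, h4, ← sum_mul] at h6
  have h7 : (Y.card : ℝ) * (δ / 2 * ((Y.card : ℝ) - 1)) ≤ Y.card * ∑ i, ((min (Y.filter fun x => ¬ R x i).card
      (Y.filter fun x => R x i).card : ℕ) : ℝ) := by
    linarith
  exact le_of_mul_le_mul_left h7 hn

lemma haussler (R : V → ι → Prop) (X : Finset V) (δ : ℝ) (hδ0 : 0 ≤ δ) (k P : ℕ) (hm : Nonempty ι)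
    (hδ : ∀ x ∈ X, ∀ y ∈ X, x ≠ y → δ ≤ ((univ.filter fun i => ¬ (R x i ↔ R y i)).card : ℝ))
    (hk : ∀ (a : κ → ι) T, (X.image (trc R a)).Shatters T → T.card ≤ k)
    (hP : ∀ (a : κ → ι), (X.image (trc R a)).card ≤ P) :
    Fintype.card κ * (δ / 2 * ((X.card : ℝ) - P)) ≤ Fintype.card ι * (k * X.card) := by
  let W : (κ → ι) → Finset κ → ℕ := fun a A => (X.filter fun x => trc R a x = A).card
  let G : κ → (κ → ι) → ℝ := fun j a =>
    ((∑ A ∈ univ.filter (fun A : Finset κ => j ∉ A), min (W a A) (W a (insert j A)) : ℕ) : ℝ)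
  have hup : ∀ a, ∑ j, G j a ≤ k * X.card := by
    intro a
    have h1 := edge_weight (W a) k (by
      intro T hT
      apply hk a
      apply hT.mono_left
      intro A
      simp only [W, mem_filter, card_pos, mem_univ, true_and, mem_image]
      rintro ⟨x, hx⟩
      exact ⟨x, mem_filter.1 hx⟩)
    have h2 : ∑ A, W a A = X.card :=
      (card_eq_sum_card_fiberwise (f := trc R a) (t := univ) (fun x _ => by simp)).symm
    rw [h2] at h1
    simp only [G]
    exact_mod_cast h1
  have hlow : ∀ j (a : κ → ι), δ / 2 * ((X.card : ℝ) - P) ≤ ∑ i, G j (Function.update a j i) := by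
    intro j a
    let g : V → Finset κ := fun x => (trc R a x).erase j
    let Q := X.image g
    have hQ : Q.card ≤ P := by
      have : Q = (X.image (trc R a)).image (fun A => A.erase j) := by
        simp only [Q, image_image]; rfl
      rw [this]
      exact card_image_le.trans (hP a)
    have hX : (X.card : ℝ) = ∑ A ∈ Q, ((X.filter fun x => g x = A).card : ℝ) := by
      have := card_eq_sum_card_fiberwise (f := g) (s := X) (t := Q)
        (fun x hx => mem_image_of_mem g hx)
      exact_mod_cast this
    have hW0 : ∀ i A, j ∉ A → W (Function.update a j i) A =
        ((X.filter fun x => g x = A).filter fun x => ¬ R x i).card := by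
      intro i A hA
      simp only [W, filter_filter]
      congr 1
      apply filter_congr
      intro x _
      simp only [g, trc, Finset.ext_iff, mem_filter, mem_univ, true_and, mem_erase]
      constructor
      · intro h
        refine ⟨fun l => ?_, ?_⟩
        · by_cases hl : l = j
          · subst hl; simpa using hA
          · have := h l; simpa [hl] using this
        · have := h j; simpa [hA] using this
      · rintro ⟨h, h'⟩ l
        by_cases hl : l = j
        · subst hl; simpa [hA] using h'
        · have := h l; simpa [hl] using this
    have hW1 : ∀ i A, j ∉ A → W (Function.update a j i) (insert j A) =
        ((X.filter fun x => g x = A).filter fun x => R x i).card := by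
      intro i A hA
      simp only [W, filter_filter]
      congr 1
      apply filter_congr
      intro x _
      simp only [g, trc, Finset.ext_iff, mem_filter, mem_univ, true_and, mem_erase, mem_insert]
      constructor
      · intro h
        refine ⟨fun l => ?_, ?_⟩
        · by_cases hl : l = j
          · subst hl; simpa using hA
          · have := h l; simpa [hl] using this
        · have := h j; simpa using this
      · rintro ⟨h, h'⟩ l
        by_cases hl : l = j
        · subst hl; simpa using h'
        · have := h l; simpa [hl] using this
    have hQj : ∀ A ∈ Q, j ∉ A := by
      intro A hA
      obtain ⟨x, _, rfl⟩ := mem_image.1 hA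
      simp [g]
    calc δ / 2 * ((X.card : ℝ) - P) ≤ δ / 2 * ((X.card : ℝ) - Q.card) := by
          have : (Q.card : ℝ) ≤ P := by exact_mod_cast hQ
          gcongr
      _ = ∑ A ∈ Q, δ / 2 * (((X.filter fun x => g x = A).card : ℝ) - 1) := by
          rw [← mul_sum, sum_sub_distrib, ← hX]; simp
      _ ≤ ∑ A ∈ Q, ∑ i, ((min ((X.filter fun x => g x = A).filter fun x => ¬ R x i).card
            ((X.filter fun x => g x = A).filter fun x => R x i).card : ℕ) : ℝ) := by
          apply sum_le_sum
          intro A hA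
          apply split_bound
          · intro x hx y hy
            exact hδ x (mem_filter.1 hx).1 y (mem_filter.1 hy).1
          · obtain ⟨x, hx, rfl⟩ := mem_image.1 hA
            exact ⟨x, by simp [hx]⟩
      _ = ∑ i, ∑ A ∈ Q, ((min (W (Function.update a j i) A)
            (W (Function.update a j i) (insert j A)) : ℕ) : ℝ) := by
          rw [sum_comm]
          refine sum_congr rfl fun i _ => sum_congr rfl fun A hA => ?_
          rw [hW0 i A (hQj A hA), hW1 i A (hQj A hA)]
      _ ≤ ∑ i, G j (Function.update a j i) := by
          apply sum_le_sum
          intro i _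
          simp only [G]
          push_cast
          apply sum_le_sum_of_subset_of_nonneg
          · intro A hA
            simp [hQj A hA]
          · intro A _ _
            positivity
  have htot1 : ∑ j, ∑ a : κ → ι, ∑ i, G j (Function.update a j i) ≤
      Fintype.card ι * (Fintype.card (κ → ι) * (k * X.card)) := by
    simp_rw [sum_update, ← mul_sum]
    rw [sum_comm]
    gcongr
    calc _ ≤ ∑ a : κ → ι, (k * X.card : ℝ) := sum_le_sum fun a _ => hup a
      _ = _ := by simp
  have htot2 : (Fintype.card κ : ℝ) * (Fintype.card (κ → ι) * (δ / 2 * ((X.card : ℝ) - P))) ≤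
      ∑ j, ∑ a : κ → ι, ∑ i, G j (Function.update a j i) := by
    calc _ = ∑ j : κ, ∑ a : κ → ι, δ / 2 * ((X.card : ℝ) - P) := by
          simp only [sum_const, card_univ, nsmul_eq_mul]
      _ ≤ _ := sum_le_sum fun j _ => sum_le_sum fun a _ => hlow j a
  have hpos : (0 : ℝ) < Fintype.card (κ → ι) := by
    exact_mod_cast Fintype.card_pos
  have := htot2.trans htot1
  apply le_of_mul_le_mul_left _ hpos
  linarith
end haussler
section geom
variable {d : ℕ} {κ : Type*}

lemma crit_sep (c : κ → EuclideanSpace ℝ (Fin d)) (T : Finset κ) (z : EuclideanSpace ℝ (Fin d))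
    (hz : z ∉ affineSpan ℝ (c '' T)) :
    ∃ β : EuclideanSpace ℝ (Fin d) → Prop, ∀ p p' : EuclideanSpace ℝ (Fin d),
      (∀ i ∈ T, dist p (c i) = dist p' (c i)) →
      p - z ∈ Submodule.span ℝ ((fun i => p - c i) '' (T : Set κ)) →
      p' - z ∈ Submodule.span ℝ ((fun i => p' - c i) '' (T : Set κ)) →
      (β p ↔ β p') → p = p' := by
  rcases T.eq_empty_or_nonempty with rfl | ⟨i0, hi0⟩
  · refine ⟨fun _ => True, fun p p' _ h1 h2 _ => ?_⟩
    simp [sub_eq_zero] at h1 h2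
    rw [h1, h2]
  set W := vectorSpan ℝ (c '' T) with hW
  have hWd : (affineSpan ℝ (c '' T)).direction = W := direction_affineSpan ℝ _
  obtain ⟨w0, hw0, u, hu, hwu⟩ := Submodule.exists_add_mem_mem_orthogonal (K := W) (z - c i0)
  have hcA : ∀ i ∈ T, c i ∈ affineSpan ℝ (c '' T) := fun i hi =>
    subset_affineSpan ℝ _ ⟨i, hi, rfl⟩
  set z0 := c i0 + w0 with hz0
  have hz0A : z0 ∈ affineSpan ℝ (c '' T) := by
    have := AffineSubspace.vadd_mem_of_mem_direction (v := w0) (by rw [hWd]; exact hw0) (hcA i0 hi0)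
    simpa [hz0, add_comm] using this
  have huz : u = z - z0 := by
    rw [hz0, sub_add_eq_sub_sub, hwu]; simp
  have hu0 : u ≠ 0 := by
    intro h
    rw [h] at huz
    rw [sub_eq_zero.1 huz.symm] at hz
    exact hz hz0A
  have hcW : ∀ i ∈ T, c i - z0 ∈ W := by
    intro i hi
    rw [← hWd]
    exact AffineSubspace.vsub_mem_direction (hcA i hi) hz0A
  have horth : ∀ w ∈ W, inner ℝ w u = 0 := fun w hw => hu w hw
  have decomp : ∀ p : EuclideanSpace ℝ (Fin d),
      p - z ∈ Submodule.span ℝ ((fun i => p - c i) '' (T : Set κ)) →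
      ∃ α : ℝ, α ≠ 0 ∧ ∃ w ∈ W, p - z0 = α • u + w := by
    intro p hp
    rw [Submodule.mem_span_image_finset_iff_exists_fun] at hp
    obtain ⟨l, hl⟩ := hp
    set lam := ∑ i, l i with hlam
    set w' := ∑ i : T, l i • (c i - z0) with hw'
    have hw'W : w' ∈ W := Submodule.sum_mem _ fun i _ => Submodule.smul_mem _ _ (hcW i i.2)
    have e1 : (1 - lam) • (p - z0) = u - w' := by
      have : ∑ i : T, l i • (p - c i) = lam • (p - z0) - w' := by
        rw [hlam, hw', sum_smul, ← sum_sub_distrib]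
        refine sum_congr rfl fun i _ => ?_
        rw [← smul_sub]; congr 1; abel
      rw [this] at hl
      have h2 : w' = lam • (p - z0) - (p - z) := by rw [← hl]; abel
      rw [h2, huz, sub_smul, one_smul]
      abel
    have hlam1 : 1 - lam ≠ 0 := by
      intro h
      rw [h, zero_smul] at e1
      have : u = w' := (sub_eq_zero.1 e1.symm)
      have h3 := horth w' hw'W
      rw [← this] at h3
      exact hu0 (inner_self_eq_zero.1 h3)
    refine ⟨(1 - lam)⁻¹, inv_ne_zero hlam1, -((1 - lam)⁻¹ • w'), W.neg_mem (W.smul_mem _ hw'W), ?_⟩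
    rw [← sub_eq_add_neg, ← smul_sub, ← e1, smul_smul, inv_mul_cancel₀ hlam1, one_smul]
  refine ⟨fun p => 0 < inner ℝ (p - z0) u, fun p p' hd h1 h2 hβ => ?_⟩
  obtain ⟨α, hα, w, hw, hp⟩ := decomp p h1
  obtain ⟨α', hα', w', hw', hp'⟩ := decomp p' h2
  have hle : affineSpan ℝ (c '' T) ≤ AffineSubspace.perpBisector p p' := by
    rw [affineSpan_le]
    rintro _ ⟨i, hi, rfl⟩
    rw [SetLike.mem_coe, AffineSubspace.mem_perpBisector_iff_dist_eq, dist_comm, dist_comm (c i)]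
    exact hd i hi
  have hdz : dist z0 p = dist z0 p' :=
    AffineSubspace.mem_perpBisector_iff_dist_eq.1 (hle hz0A)
  have hWp : ∀ v ∈ W, inner ℝ (p' - p) v = 0 := by
    intro v hv
    have := AffineSubspace.direction_le hle
    rw [hWd, AffineSubspace.direction_perpBisector] at this
    exact Submodule.mem_orthogonal_singleton_iff_inner_right.1 (this hv)
  have e2 : p' - p = (α' - α) • u + (w' - w) := by
    have : p' - p = (p' - z0) - (p - z0) := by abel
    rw [this, hp, hp', sub_smul]; abel
  have hww : w' - w = 0 := by
    have hv := W.sub_mem hw' hw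
    have := hWp _ hv
    rw [e2, inner_add_left, inner_smul_left, real_inner_comm, horth _ hv] at this
    simp at this
    exact this
  have hww' : w' = w := sub_eq_zero.1 hww
  have hn : ‖p - z0‖ ^ 2 = ‖p' - z0‖ ^ 2 := by
    rw [← dist_eq_norm, ← dist_eq_norm, dist_comm, hdz, dist_comm]
  have hin : ∀ α : ℝ, inner ℝ (α • u + w) u = α * ‖u‖ ^ 2 := by
    intro α
    rw [inner_add_left, horth w hw, inner_smul_left, real_inner_self_eq_norm_sq]; simp
  have hun : 0 < ‖u‖ ^ 2 := by positivity
  simp only [hp, hp', hww', hin] at hβ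
  rw [hp, hp', hww', norm_add_sq_real, norm_add_sq_real, norm_smul, norm_smul, inner_smul_left,
    inner_smul_left, real_inner_comm, horth w hw, mul_pow, mul_pow] at hn
  simp at hn
  have hsq : α ^ 2 = α' ^ 2 := by
    rcases hn with h | h
    · exact h
    · exact absurd h hu0
  have : α = α' := by
    rcases sq_eq_sq_iff_eq_or_eq_neg.1 hsq with h | h
    · exact h
    · exfalso
      rw [h] at hβ
      rcases lt_or_gt_of_ne hα' with h' | h'
      · have a1 : 0 < -α' * ‖u‖ ^ 2 := mul_pos (by linarith) hun
        have := hβ.1 a1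
        nlinarith
      · have a1 : 0 < α' * ‖u‖ ^ 2 := mul_pos h' hun
        have := hβ.2 a1
        nlinarith
  have e3 : p - z0 = p' - z0 := by rw [hp, hp', hww', this]
  exact sub_left_injective e3

lemma crit_finite (c : κ → EuclideanSpace ℝ (Fin d)) (ρ : κ → ℝ) (T : Finset κ)
    (z : EuclideanSpace ℝ (Fin d)) :
    {r : ℝ | ∃ p : EuclideanSpace ℝ (Fin d), (∀ i ∈ T, dist p (c i) ^ 2 = ρ i) ∧
      p - z ∈ Submodule.span ℝ ((fun i => p - c i) '' (T : Set κ)) ∧ dist p z ^ 2 = r}.Finite := by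
  have hdd : ∀ p p' : EuclideanSpace ℝ (Fin d), (∀ i ∈ T, dist p (c i) ^ 2 = ρ i) →
      (∀ i ∈ T, dist p' (c i) ^ 2 = ρ i) → ∀ i ∈ T, dist p (c i) = dist p' (c i) := by
    intro p p' h1 h2 i hi
    exact (sq_eq_sq₀ dist_nonneg dist_nonneg).1 ((h1 i hi).trans (h2 i hi).symm)
  by_cases hz : z ∈ affineSpan ℝ (c '' T)
  · apply Set.Subsingleton.finite
    rintro _ ⟨p, h1, -, rfl⟩ _ ⟨p', h1', -, rfl⟩
    have hle : affineSpan ℝ (c '' T) ≤ AffineSubspace.perpBisector p p' := by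
      rw [affineSpan_le]
      rintro _ ⟨i, hi, rfl⟩
      rw [SetLike.mem_coe, AffineSubspace.mem_perpBisector_iff_dist_eq, dist_comm, dist_comm (c i)]
      exact hdd p p' h1 h1' i hi
    have := AffineSubspace.mem_perpBisector_iff_dist_eq.1 (hle hz)
    rw [dist_comm, this, dist_comm]
  · obtain ⟨β, hβ⟩ := crit_sep c T z hz
    have hfin : {p : EuclideanSpace ℝ (Fin d) | (∀ i ∈ T, dist p (c i) ^ 2 = ρ i) ∧
      p - z ∈ Submodule.span ℝ ((fun i => p - c i) '' (T : Set κ))}.Finite := by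
      apply Set.Finite.of_injOn (f := β) (t := Set.univ) (Set.mapsTo_univ _ _) _ Set.finite_univ
      rintro p ⟨h1, h2⟩ p' ⟨h1', h2'⟩ h
      exact hβ p p' (hdd p p' h1 h1') h2 h2' (by rw [h])
    refine (hfin.image fun p => dist p z ^ 2).subset ?_
    rintro r ⟨p, h1, h2, h3⟩
    exact ⟨p, ⟨h1, h2⟩, h3⟩

lemma generic_radii (c : κ → EuclideanSpace ℝ (Fin d)) (lo hi : κ → ℝ) (hlh : ∀ i, lo i < hi i)
    (S : Finset κ) : ∃ ρ : κ → ℝ, (∀ i, lo i < ρ i ∧ ρ i < hi i) ∧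
      ∀ T ⊆ S, ∀ p : EuclideanSpace ℝ (Fin d), (∀ i ∈ T, dist p (c i) ^ 2 = ρ i) →
        LinearIndepOn ℝ (fun i => p - c i) (T : Set κ) := by
  induction S using Finset.induction_on with
  | empty =>
    refine ⟨fun i => (lo i + hi i) / 2, fun i => ⟨by linarith [hlh i], by linarith [hlh i]⟩, ?_⟩
    intro T hT p _
    rw [subset_empty.1 hT]
    simp
  | insert j S hj ih =>
    obtain ⟨ρ, hρ, hG⟩ := ih
    have hfin : (⋃ T ∈ (S.powerset : Finset (Finset κ)),
      {r : ℝ | ∃ p : EuclideanSpace ℝ (Fin d), (∀ i ∈ T, dist p (c i) ^ 2 = ρ i) ∧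
      p - c j ∈ Submodule.span ℝ ((fun i => p - c i) '' (T : Set κ)) ∧
        dist p (c j) ^ 2 = r}).Finite :=
      Set.Finite.biUnion (S.powerset.finite_toSet) fun T _ => crit_finite c ρ T (c j)
    obtain ⟨r, hr, hr'⟩ := ((Set.Ioo_infinite (hlh j)).sdiff hfin).nonempty
    refine ⟨Function.update ρ j r, ?_, ?_⟩
    · intro i
      by_cases hij : i = j
      · subst hij; simpa using hr
      · simpa [hij] using hρ i
    · intro T hT p hp
      by_cases hjT : j ∈ T
      · have hT0 : T.erase j ⊆ S := by
          intro x hx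
          rcases mem_insert.1 (hT (mem_of_mem_erase hx)) with h | h
          · exact absurd h (ne_of_mem_erase hx)
          · exact h
        have hp0 : ∀ i ∈ T.erase j, dist p (c i) ^ 2 = ρ i := by
          intro i hi
          have := hp i (mem_of_mem_erase hi)
          rwa [Function.update_of_ne (ne_of_mem_erase hi)] at this
        have h1 := hG _ hT0 p hp0
        have e : (T : Set κ) = insert j (↑(T.erase j) : Set κ) := by
          rw [← coe_insert, insert_erase hjT]
        rw [e, linearIndepOn_insert (by simp)]
        refine ⟨h1, fun h2 => hr' ?_⟩
        simp only [Set.mem_iUnion]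
        refine ⟨T.erase j, mem_powerset.2 hT0, p, hp0, h2, ?_⟩
        have := hp j hjT
        simpa using this
      · have hT0 : T ⊆ S := by
          intro x hx
          rcases mem_insert.1 (hT hx) with h | h
          · subst h; exact absurd hx hjT
          · exact h
        apply hG T hT0 p
        intro i hi
        have := hp i hi
        rwa [Function.update_of_ne (fun h : i = j => hjT (h ▸ hi))] at this

lemma generic_point [Fintype κ] (hd : 1 ≤ d) (c : κ → EuclideanSpace ℝ (Fin d)) :
    ∃ q : EuclideanSpace ℝ (Fin d), ∀ T : Finset κ, T.card ≤ d → q ∉ affineSpan ℝ (c '' T) := by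
  by_contra hcon
  push Not at hcon
  have hT : ∀ T : Finset κ, T.card ≤ d → affineSpan ℝ (c '' T) ≠ ⊤ := by
    intro T hTd htop
    have h1 : vectorSpan ℝ (c '' T) = ⊤ := by
      rw [← direction_affineSpan, htop, AffineSubspace.direction_top]
    rcases T.eq_empty_or_nonempty with rfl | hne
    · simp at htop
    · have hp := hne.card_pos
      have := finrank_vectorSpan_image_finset_le ℝ c T (n := T.card - 1) (by omega)
      rw [coe_image, h1, finrank_top] at this
      simp at this
      omega
  have hcov : (Set.univ : Set (EuclideanSpace ℝ (Fin d))) ⊆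
      ⋃ T ∈ ((univ : Finset (Finset κ)).filter fun T => T.card ≤ d),
        (affineSpan ℝ (c '' (T : Set κ)) : Set (EuclideanSpace ℝ (Fin d))) := by
    intro q _
    obtain ⟨T, h1, h2⟩ := hcon q
    simp only [Set.mem_iUnion]
    exact ⟨T, by simp [h1], h2⟩
  have h0 : MeasureTheory.volume (Set.univ : Set (EuclideanSpace ℝ (Fin d))) = 0 := by
    apply MeasureTheory.measure_mono_null hcov
    refine (MeasureTheory.measure_biUnion_null_iff (Finset.countable_toSet _)).2 ?_
    intro T hT'
    exact MeasureTheory.Measure.addHaar_affineSubspace _ _ (hT T (by simpa using hT'))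
  have := MeasureTheory.Measure.measure_univ_ne_zero (μ := (MeasureTheory.volume :
    MeasureTheory.Measure (EuclideanSpace ℝ (Fin d)))).2 (NeZero.ne _)
  exact this h0

lemma small_t (a b k : ℝ) (h : a < 0 ∨ (a = 0 ∧ b < 0)) :
    ∀ᶠ t in nhdsWithin (0:ℝ) (Set.Ioi 0), a + b * t + k * t ^ 2 < 0 := by
  rcases h with h | ⟨h, hb⟩
  · have : Filter.Tendsto (fun t : ℝ => a + b * t + k * t ^ 2) (nhds 0) (nhds (a + b * 0 + k * 0 ^ 2)) :=
      Continuous.tendsto (by fun_prop) 0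
    have h2 := this.eventually_lt_const (u := 0) (by simpa using h)
    exact h2.filter_mono nhdsWithin_le_nhds
  · have : Filter.Tendsto (fun t : ℝ => b + k * t) (nhds 0) (nhds (b + k * 0)) :=
      Continuous.tendsto (by fun_prop) 0
    have h2 := (this.eventually_lt_const (u := 0) (by simpa using hb)).filter_mono
      (nhdsWithin_le_nhds (s := Set.Ioi 0))
    filter_upwards [h2, self_mem_nhdsWithin] with t ht ht0
    have : a + b * t + k * t ^ 2 = t * (b + k * t) := by rw [h]; ring
    rw [this]
    exact mul_neg_of_pos_of_neg ht0 ht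

lemma exists_dir (c : κ → EuclideanSpace ℝ (Fin d)) (p q : EuclideanSpace ℝ (Fin d)) (T : Finset κ)
    (hT : LinearIndepOn ℝ (fun i => p - c i) (T : Set κ))
    (hq : p - q ∉ Submodule.span ℝ ((fun i => p - c i) '' (T : Set κ))) (val : κ → ℝ) :
    ∃ h : EuclideanSpace ℝ (Fin d), inner ℝ h (p - q) = -1 ∧ ∀ i ∈ T, inner ℝ h (p - c i) = val i := by
  have hT' : LinearIndependent ℝ (fun i : (T : Set κ) => p - c i) := hT
  have e : (fun i => p - c i) '' (T : Set κ) = Set.range (fun i : (T : Set κ) => p - c i) := by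
    rw [Set.image_eq_range]
  rw [e] at hq
  let b := Module.Basis.span hT'
  obtain ⟨g, hg, hgq⟩ := LinearMap.exists_extend_of_notMem
    (b.constr ℝ (fun i : (T : Set κ) => val i)) hq (-1 : ℝ)
  refine ⟨(InnerProductSpace.toDual ℝ _).symm g.toContinuousLinearMap, ?_, ?_⟩
  · rw [InnerProductSpace.toDual_symm_apply]
    exact hgq
  · intro i hi
    rw [InnerProductSpace.toDual_symm_apply]
    have h1 : (b ⟨i, hi⟩ : EuclideanSpace ℝ (Fin d)) = p - c i :=
      congrArg Subtype.val (Module.Basis.span_apply hT' ⟨i, hi⟩)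
    have h2 := congrArg (fun f => f (b ⟨i, hi⟩)) hg
    simp only [Module.Basis.constr_basis, LinearMap.comp_apply, Submodule.subtype_apply, h1] at h2
    exact h2

lemma cell_min [Fintype κ] (c : κ → EuclideanSpace ℝ (Fin d)) (ρ : κ → ℝ)
    (hG : ∀ (T : Finset κ) (p : EuclideanSpace ℝ (Fin d)), (∀ i ∈ T, dist p (c i) ^ 2 = ρ i) →
        LinearIndepOn ℝ (fun i => p - c i) (T : Set κ))
    (q x : EuclideanSpace ℝ (Fin d)) (σ : Finset κ)
    (hx1 : ∀ i ∈ σ, dist x (c i) ^ 2 ≤ ρ i) (hx2 : ∀ i ∉ σ, ρ i ≤ dist x (c i) ^ 2) :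
    ∃ (p : EuclideanSpace ℝ (Fin d)) (T : Finset κ), (∀ i ∈ T, dist p (c i) ^ 2 = ρ i) ∧
      T.card ≤ d ∧ p - q ∈ Submodule.span ℝ ((fun i => p - c i) '' (T : Set κ)) ∧
      ∀ i ∉ T, (i ∈ σ ↔ dist p (c i) ^ 2 < ρ i) := by
  let Z : Set (EuclideanSpace ℝ (Fin d)) :=
    {y | ∀ i, (i ∈ σ → dist y (c i) ^ 2 ≤ ρ i) ∧ (i ∉ σ → ρ i ≤ dist y (c i) ^ 2)}
  have hZc : IsClosed Z := by
    simp only [Z, Set.ofPred_forall, Set.ofPred_and]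
    refine isClosed_iInter fun i => IsClosed.inter ?_ ?_
    · refine isClosed_iInter fun _ => isClosed_le (by fun_prop) (by fun_prop)
    · refine isClosed_iInter fun _ => isClosed_le (by fun_prop) (by fun_prop)
  obtain ⟨p, hpZ, hpmin⟩ := hZc.exists_infDist_eq_dist ⟨x, fun i => ⟨hx1 i, hx2 i⟩⟩ q
  let T : Finset κ := univ.filter fun i => dist p (c i) ^ 2 = ρ i
  have hTt : ∀ i ∈ T, dist p (c i) ^ 2 = ρ i := fun i hi => (mem_filter.1 hi).2
  have hli := hG T p hTt
  refine ⟨p, T, hTt, ?_, ?_, ?_⟩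
  · have h := LinearIndependent.fintype_card_le_finrank (R := ℝ) (b := fun i : T => p - c i) hli
    simpa using h
  · by_contra hq
    obtain ⟨h, hhq, hhT⟩ := exists_dir c p q T hli hq (fun i => if i ∈ σ then -1 else 1)
    have expand : ∀ (z : EuclideanSpace ℝ (Fin d)) (t : ℝ), dist (p + t • h) z ^ 2 =
        dist p z ^ 2 + 2 * inner ℝ h (p - z) * t + ‖h‖ ^ 2 * t ^ 2 := by
      intro z t
      rw [dist_eq_norm, dist_eq_norm, show p + t • h - z = (p - z) + t • h by abel,
        norm_add_sq_real, inner_smul_right, real_inner_comm, norm_smul, mul_pow, Real.norm_eq_abs,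
        sq_abs]
      ring
    have ev1 : ∀ i, ∀ᶠ t in nhdsWithin (0:ℝ) (Set.Ioi 0),
        (i ∈ σ → dist (p + t • h) (c i) ^ 2 ≤ ρ i) ∧
          (i ∉ σ → ρ i ≤ dist (p + t • h) (c i) ^ 2) := by
      intro i
      by_cases hi : i ∈ σ
      · have := small_t (dist p (c i) ^ 2 - ρ i) (2 * inner ℝ h (p - c i)) (‖h‖ ^ 2) (by
          rcases ((hpZ i).1 hi).lt_or_eq with h1 | h1
          · left; linarith
          · right
            refine ⟨by linarith, ?_⟩
            rw [hhT i (by simp [T, h1])]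
            simp [hi])
        filter_upwards [this] with t ht
        refine ⟨fun _ => ?_, fun h' => absurd hi h'⟩
        rw [expand]; linarith
      · have := small_t (ρ i - dist p (c i) ^ 2) (-(2 * inner ℝ h (p - c i))) (-‖h‖ ^ 2) (by
          rcases ((hpZ i).2 hi).lt_or_eq with h1 | h1
          · left; linarith
          · right
            refine ⟨by linarith, ?_⟩
            rw [hhT i (by simp [T, h1])]
            simp [hi])
        filter_upwards [this] with t ht
        refine ⟨fun h' => absurd h' hi, fun _ => ?_⟩
        rw [expand]; linarith
    have ev2 := Filter.eventually_all.2 ev1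
    have ev3 := small_t 0 (2 * inner ℝ h (p - q)) (‖h‖ ^ 2) (Or.inr ⟨rfl, by rw [hhq]; norm_num⟩)
    obtain ⟨t, ht1, ht2⟩ := (ev2.and ev3).exists
    have hmem : p + t • h ∈ Z := ht1
    have h1 := Metric.infDist_le_dist_of_mem (x := q) hmem
    rw [hpmin, dist_comm, dist_comm q] at h1
    have h2 := pow_le_pow_left₀ dist_nonneg h1 2
    rw [expand q t] at h2
    linarith
  · intro i hi
    have hne : dist p (c i) ^ 2 ≠ ρ i := fun h => hi (by simp [T, h])
    constructor
    · intro h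
      exact lt_of_le_of_ne ((hpZ i).1 h) hne
    · intro h
      by_contra h'
      exact absurd ((hpZ i).2 h') (not_le.2 h)

lemma card_small_finsets (α : Type*) [Fintype α] (d : ℕ) :
    ((univ : Finset (Finset α)).filter fun A => A.card ≤ d).card ≤ (Fintype.card α + 1) ^ d := by
  have h1 : (Fintype.card α + 1) ^ d = (univ : Finset (Fin d → Option α)).card := by
    simp
  rw [h1]
  apply card_le_card_of_surjOn (fun g : Fin d → Option α => univ.filter fun a => ∃ i, g i = some a)
  intro A hA
  simp only [coe_filter, mem_univ, true_and, Set.mem_ofPred_eq] at hA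
  refine ⟨fun i => if h : i.1 < A.card then some (A.equivFin.symm ⟨i, h⟩ : α) else none, by simp, ?_⟩
  ext a
  simp only [mem_filter, mem_univ, true_and]
  constructor
  · rintro ⟨i, hi⟩
    split_ifs at hi with h
    · have := Option.some.inj hi
      rw [← this]
      exact (A.equivFin.symm ⟨i, h⟩).2
  · intro ha
    refine ⟨⟨A.equivFin ⟨a, ha⟩, (A.equivFin ⟨a, ha⟩).2.trans_le hA⟩, ?_⟩
    simp

lemma pattern_count [Fintype κ] (hd : 1 ≤ d) (c : κ → EuclideanSpace ℝ (Fin d)) (r : κ → ℝ)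
    (hr : ∀ i, 0 ≤ r i) (X : Finset (EuclideanSpace ℝ (Fin d))) :
    (X.image fun x => (univ.filter fun i => dist x (c i) ≤ r i : Finset κ)).card ≤
      (2 * Fintype.card κ + 1) ^ d * 2 := by
  have hhi : ∀ i, ∃ hi, r i ^ 2 < hi ∧ ∀ x ∈ X, r i < dist x (c i) → hi ≤ dist x (c i) ^ 2 := by
    intro i
    have ev : ∀ᶠ t in nhdsWithin (r i ^ 2) (Set.Ioi (r i ^ 2)),
        ∀ x ∈ X, r i < dist x (c i) → t ≤ dist x (c i) ^ 2 := by
      rw [Finset.eventually_all]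
      intro x _
      by_cases h : r i < dist x (c i)
      · have h2 : r i ^ 2 < dist x (c i) ^ 2 := pow_lt_pow_left₀ h (hr i) two_ne_zero
        filter_upwards [nhdsWithin_le_nhds (Iio_mem_nhds h2)] with t ht _
        exact le_of_lt ht
      · exact Filter.Eventually.of_forall fun t h' => absurd h' h
    obtain ⟨t, h1, h2⟩ := (ev.and self_mem_nhdsWithin).exists
    exact ⟨t, h2, h1⟩
  choose hi hlt hhi using hhi
  obtain ⟨ρ, hρ, hG⟩ := generic_radii c (fun i => r i ^ 2) hi hlt univ
  obtain ⟨q, hq⟩ := generic_point hd c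
  have hcell : ∀ σ : Finset κ, σ ∈ (X.image fun x => (univ.filter fun i => dist x (c i) ≤ r i)) →
    ∃ (p : EuclideanSpace ℝ (Fin d)) (T : Finset κ), (∀ i ∈ T, dist p (c i) ^ 2 = ρ i) ∧
      T.card ≤ d ∧ p - q ∈ Submodule.span ℝ ((fun i => p - c i) '' (T : Set κ)) ∧
      ∀ i ∉ T, (i ∈ σ ↔ dist p (c i) ^ 2 < ρ i) := by
    intro σ hσ
    obtain ⟨x, hx, rfl⟩ := mem_image.1 hσ
    apply cell_min c ρ (fun T p => hG T (subset_univ T) p) q x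
    · intro i hi'
      have := (mem_filter.1 hi').2
      have := pow_le_pow_left₀ dist_nonneg this 2
      linarith [(hρ i).1]
    · intro i hi'
      have : r i < dist x (c i) := by simpa using hi'
      linarith [hhi i x hx this, (hρ i).2]
  choose! p T hT1 hT2 hT3 hT4 using hcell
  have hβ : ∀ T : Finset κ, ∃ β : EuclideanSpace ℝ (Fin d) → Prop, T.card ≤ d →
      ∀ p p' : EuclideanSpace ℝ (Fin d),
      (∀ i ∈ T, dist p (c i) = dist p' (c i)) →
      p - q ∈ Submodule.span ℝ ((fun i => p - c i) '' (T : Set κ)) →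
      p' - q ∈ Submodule.span ℝ ((fun i => p' - c i) '' (T : Set κ)) →
      (β p ↔ β p') → p = p' := by
    intro T
    by_cases h : T.card ≤ d
    · obtain ⟨β, hβ⟩ := crit_sep c T q (hq T h)
      exact ⟨β, fun _ => hβ⟩
    · exact ⟨fun _ => True, fun h' => absurd h' h⟩
  choose β hβ using hβ
  have hcount := card_small_finsets (κ × Bool) d
  simp only [Fintype.card_prod, Fintype.card_bool] at hcount
  rw [mul_comm 2]
  refine le_trans ?_ (Nat.mul_le_mul_right 2 hcount)
  rw [← Fintype.card_bool, ← card_univ (α := Bool), ← card_product]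
  apply card_le_card_of_injOn (fun σ : Finset κ =>
    ((T σ).image (fun i => (i, decide (i ∈ σ))), decide (β (T σ) (p σ))))
  · intro σ hσ
    simp only [coe_product, Set.mem_prod, mem_coe, mem_filter, mem_univ, true_and, and_true]
    exact card_image_le.trans (hT2 σ hσ)
  · intro σ hσ σ' hσ' heq
    simp only [Prod.mk.injEq, decide_eq_decide] at heq
    obtain ⟨he, hb⟩ := heq
    have hTT : T σ = T σ' := by
      have := congrArg (fun A => A.image Prod.fst) he
      simpa [image_image, Function.comp_def] using this
    have hpp : p σ = p σ' := by
      apply hβ (T σ) (hT2 σ hσ) (p σ) (p σ')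
      · intro i hi
        have h1 := hT1 σ hσ i hi
        have h2 := hT1 σ' hσ' i (hTT ▸ hi)
        exact (sq_eq_sq₀ dist_nonneg dist_nonneg).1 (h1.trans h2.symm)
      · exact hT3 σ hσ
      · rw [hTT]; exact hT3 σ' hσ'
      · rw [hb, hTT]
    ext i
    by_cases hi : i ∈ T σ
    · have h1 : (i, decide (i ∈ σ)) ∈ (T σ).image (fun i => (i, decide (i ∈ σ))) :=
        mem_image_of_mem _ hi
      rw [he] at h1
      obtain ⟨k, hk, hk2⟩ := mem_image.1 h1
      simp only [Prod.mk.injEq, decide_eq_decide] at hk2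
      obtain ⟨rfl, h3⟩ := hk2
      exact h3.symm
    · rw [hT4 σ hσ i hi, hT4 σ' hσ' i (hTT ▸ hi), hpp]
end geom
lemma ball_form {d : ℕ} (x c : EuclideanSpace ℝ (Fin d)) (r : ℝ) (hr : 0 ≤ r) :
    dist x c ≤ r ↔ (‖c‖ ^ 2 - r ^ 2) + ‖x‖ ^ 2 - 2 * inner ℝ c x ≤ 0 := by
  rw [← sq_le_sq₀ dist_nonneg hr, dist_eq_norm, norm_sub_sq_real, real_inner_comm]
  constructor <;> intro h <;> linarith

lemma short_edge {d : ℕ} (hd : 2 ≤ d) {ι : Type*} [Fintype ι] (c : ι → EuclideanSpace ℝ (Fin d))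
    (r : ι → ℝ) (hr : ∀ i, 0 ≤ r i) (X : Finset (EuclideanSpace ℝ (Fin d)))
    (hX : 16 ^ d ≤ X.card) :
    ∃ x ∈ X, ∃ y ∈ X, x ≠ y ∧
      ((univ.filter fun i => ¬ (dist x (c i) ≤ r i ↔ dist y (c i) ≤ r i)).card : ℝ) ≤
        130 * (d + 2) * Fintype.card ι / (X.card : ℝ) ^ (1 / (d : ℝ)) := by
  set n := X.card with hn
  have hd0 : (0 : ℝ) < d := by exact_mod_cast (by omega : 0 < d)
  have hXr : (16 : ℝ) ^ d ≤ n := by exact_mod_cast hX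
  have hnpos : (0 : ℝ) < n := lt_of_lt_of_le (by positivity) hXr
  set N := (n : ℝ) ^ (1 / (d : ℝ)) with hN
  have hNd : N ^ d = n := by
    rw [hN, ← Real.rpow_natCast, ← Real.rpow_mul hnpos.le]
    field_simp
    simp
  have hN16 : 16 ≤ N := by
    have h0 : 0 ≤ N := by positivity
    rw [← hNd] at hXr
    exact (pow_le_pow_iff_left₀ (by norm_num) h0 (by omega)).1 hXr
  by_contra hcon
  have hcon' : ∀ x ∈ X, ∀ y ∈ X, x ≠ y → 130 * (d + 2) * Fintype.card ι / N <
      ((univ.filter fun i => ¬ (dist x (c i) ≤ r i ↔ dist y (c i) ≤ r i)).card : ℝ) := by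
    intro x hx y hy hxy
    by_contra h
    exact hcon ⟨x, hx, y, hy, hxy, not_lt.1 h⟩
  have hι : Nonempty ι := by
    by_contra hι
    rw [not_nonempty_iff] at hι
    have h1 : 1 < X.card := by
      rw [← hn]
      exact lt_of_lt_of_le (Nat.one_lt_pow (by omega) (by norm_num)) hX
    obtain ⟨x, hx, y, hy, hxy⟩ := one_lt_card.1 h1
    have := hcon' x hx y hy hxy
    simp at this
  have hm : (0 : ℝ) < Fintype.card ι := by exact_mod_cast Fintype.card_pos
  set s := ⌈N / 32⌉₊ with hs
  have hs1 : N / 32 ≤ s := Nat.le_ceil _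
  have hs2 : (s : ℝ) < N / 32 + 1 := Nat.ceil_lt_add_one (by positivity)
  obtain ⟨κ, hf, hκ⟩ : ∃ (κ : Type) (_ : Fintype κ), Fintype.card κ = s :=
    ⟨Fin s, inferInstance, by simp⟩
  have H := haussler (κ := κ) (fun (x : EuclideanSpace ℝ (Fin d)) i => dist x (c i) ≤ r i) X
    (130 * (d + 2) * Fintype.card ι / N) (by positivity) (d + 1) ((2 * s + 1) ^ d * 2) hι
    (fun x hx y hy hxy => (hcon' x hx y hy hxy).le) (by
      intro a T hT
      apply vc_lemma (fun j => c (a j)) (fun j => ‖c (a j)‖ ^ 2 - r (a j) ^ 2) T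
      intro S hS
      obtain ⟨A, hA, hTA⟩ := hT hS
      obtain ⟨x, hx, rfl⟩ := mem_image.1 hA
      refine ⟨x, ‖x‖ ^ 2, fun j hj => ?_⟩
      rw [← ball_form x (c (a j)) (r (a j)) (hr _), ← hTA]
      simp [trc, hj]) (by
      intro a
      have := pattern_count (by omega) (fun j => c (a j)) (fun j => r (a j)) (fun j => hr _) X
      rw [hκ] at this
      exact this)
  rw [← hn] at H
  rw [hκ] at H
  set P : ℝ := (((2 * s + 1) ^ d * 2 : ℕ) : ℝ) with hP
  have hPle : P ≤ n / 8 := by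
    rw [hP]
    push_cast
    have h1 : (2 * (s : ℝ) + 1) ≤ N / 4 := by linarith
    have h2 : (2 * (s : ℝ) + 1) ^ d ≤ (N / 4) ^ d := pow_le_pow_left₀ (by positivity) h1 d
    rw [div_pow, hNd] at h2
    have h3 : (16 : ℝ) ≤ 4 ^ d := by
      calc (16 : ℝ) = 4 ^ 2 := by norm_num
        _ ≤ 4 ^ d := pow_le_pow_right₀ (by norm_num) hd
    have h4 : (n : ℝ) / 4 ^ d ≤ n / 16 := div_le_div_of_nonneg_left hnpos.le (by norm_num) h3
    linarith
  have hNpos : 0 < N := by linarith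
  have H2 : (s : ℝ) / N * (65 * (d + 2) * (n - P)) ≤ (d + 1) * n := by
    apply le_of_mul_le_mul_left _ hm
    push_cast at H
    calc _ = (s : ℝ) * (130 * (d + 2) * Fintype.card ι / N / 2 * (n - P)) := by ring
      _ ≤ _ := H
  have H3 : (1 : ℝ) / 32 ≤ s / N := by
    rw [div_le_div_iff₀ (by norm_num) hNpos]; linarith
  have H4 : (0 : ℝ) ≤ 65 * (d + 2) * (n - P) := by
    apply mul_nonneg (by positivity); linarith
  have H5 := mul_le_mul_of_nonneg_right H3 H4
  have H6 : (1 : ℝ) / 32 * (65 * (d + 2) * (n * (7 / 8))) ≤ 1 / 32 * (65 * (d + 2) * (n - P)) := by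
    gcongr
    linarith
  nlinarith

lemma cross_insert {V : Type*} [DecidableEq V] (M : Finset (Finset V)) (x y : V) (B : Set V) :
    regionCrossCount (insert {x, y} M) B ≤
      regionCrossCount M B + (if ¬ (x ∈ B ↔ y ∈ B) then 1 else 0) := by
  unfold regionCrossCount
  rw [filter_insert]
  split_ifs with h1 h2 h2
  · exfalso
    simp at h1
    tauto
  · exact card_insert_le _ _
  · omega
  · omega

lemma pm_insert {V : Type*} [DecidableEq V] (X : Finset V) (M : Finset (Finset V)) (x y : V) (hx : x ∈ X)
    (hy : y ∈ X) (hxy : x ≠ y) (hM : IsPerfectMatching ((X.erase x).erase y) M) :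
    IsPerfectMatching X (insert {x, y} M) := by
  obtain ⟨h1, h2, h3, h4⟩ := hM
  have hsub : ∀ e ∈ M, ∀ z ∈ e, z ∈ (X.erase x).erase y := by
    intro e he z hz
    rw [← h3]
    exact mem_biUnion.2 ⟨e, he, hz⟩
  refine ⟨?_, ?_, ?_, ?_⟩
  · intro e he
    rcases mem_insert.1 he with rfl | he
    · left; exact card_pair hxy
    · exact h1 e he
  · rw [coe_insert]
    apply h2.insert
    intro e he _
    simp only [id]
    rw [disjoint_left]
    intro z hz hz2
    have := hsub e he z hz2
    simp only [mem_insert, mem_singleton] at hz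
    simp only [mem_erase] at this
    tauto
  · rw [biUnion_insert, h3]
    ext z
    simp only [id, mem_union, mem_insert, mem_singleton, mem_erase]
    constructor
    · rintro ((rfl | rfl) | h)
      · exact hx
      · exact hy
      · exact h.2.2
    · intro hz
      tauto
  · rw [filter_insert, if_neg]
    · exact h4
    · rw [card_pair hxy]; norm_num

lemma rpow_step (d n : ℕ) (hd : 2 ≤ d) (hn : 2 ≤ n) :
    2 * (1 - 1 / (d : ℝ)) / (n : ℝ) ^ (1 / (d : ℝ)) + ((n - 2 : ℕ) : ℝ) ^ (1 - 1 / (d : ℝ)) ≤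
      (n : ℝ) ^ (1 - 1 / (d : ℝ)) := by
  have hd2 : (2 : ℝ) ≤ d := by exact_mod_cast hd
  have hn2 : (2 : ℝ) ≤ n := by exact_mod_cast hn
  have hn0 : (0 : ℝ) < n := by linarith
  have hinv : 1 / (d : ℝ) ≤ 1 / 2 := one_div_le_one_div_of_le (by norm_num) hd2
  have hinv0 : 0 < 1 / (d : ℝ) := by positivity
  set γ := 1 - 1 / (d : ℝ) with hγ
  have hγn : (n : ℝ) ^ γ = n / (n : ℝ) ^ (1 / (d : ℝ)) := by
    rw [hγ, Real.rpow_sub hn0, Real.rpow_one]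
  have hfrac : (2 : ℝ) / n ≤ 1 := by rw [div_le_one hn0]; exact hn2
  have hb := rpow_one_add_le_one_add_mul_self (s := -(2 / (n : ℝ))) (p := γ)
    (by linarith) (by linarith) (by linarith)
  have e : ((n - 2 : ℕ) : ℝ) = n * (1 + -(2 / (n : ℝ))) := by
    rw [Nat.cast_sub hn]; field_simp; push_cast; ring
  rw [e, Real.mul_rpow hn0.le (by linarith)]
  have h1 := mul_le_mul_of_nonneg_left hb (Real.rpow_nonneg hn0.le γ)
  have h2 : (n : ℝ) ^ γ * (1 + γ * -(2 / (n : ℝ))) =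
      (n : ℝ) ^ γ - 2 * γ / (n : ℝ) ^ (1 / (d : ℝ)) := by
    rw [mul_add, mul_one, hγn]; field_simp; ring
  linarith

lemma mwu {d : ℕ} (hd : 2 ≤ d) {ι : Type*} [Fintype ι] (c : ι → EuclideanSpace ℝ (Fin d))
    (r : ι → ℝ) (hr : ∀ i, 0 ≤ r i) : ∀ (n : ℕ) (X : Finset (EuclideanSpace ℝ (Fin d))),
    X.card = n → ∀ w : ι → ℕ, ∃ M : Finset (Finset (EuclideanSpace ℝ (Fin d))),
      IsPerfectMatching X M ∧
      ((∑ b, w b * 2 ^ regionCrossCount M (Metric.closedBall (c b) (r b)) : ℕ) : ℝ) ≤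
        (∑ b, w b : ℕ) * Real.exp (((min n (16 ^ d) : ℕ) : ℝ) * Real.log 2 +
          65 * (d + 2) / (1 - 1 / (d : ℝ)) * (n : ℝ) ^ (1 - 1 / (d : ℝ))) := by
  have hd2 : (2 : ℝ) ≤ d := by exact_mod_cast hd
  have hinv : 1 / (d : ℝ) ≤ 1 / 2 := one_div_le_one_div_of_le (by norm_num) hd2
  have hinv0 : 0 < 1 / (d : ℝ) := by positivity
  have hlog2 : 0 < Real.log 2 := Real.log_pos (by norm_num)
  have hγ : 0 < 1 - 1 / (d : ℝ) := by linarith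
  intro n
  induction n using Nat.strong_induction_on with
  | _ n ih =>
  intro X hX w
  by_cases hn : n < 2
  · have hexp : ∀ z : ℝ, 0 ≤ z → ((∑ b, w b : ℕ) : ℝ) ≤ (∑ b, w b : ℕ) * Real.exp z := by
      intro z hz
      exact le_mul_of_one_le_right (by positivity) (Real.one_le_exp hz)
    have hM : ∃ M : Finset (Finset (EuclideanSpace ℝ (Fin d))), IsPerfectMatching X M ∧
        ∀ B, regionCrossCount M B = 0 := by
      rcases (by omega : n = 0 ∨ n = 1) with rfl | rfl
      · rw [card_eq_zero] at hX
        subst hX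
        exact ⟨∅, by simp [IsPerfectMatching], by simp [regionCrossCount]⟩
      · obtain ⟨x, rfl⟩ := card_eq_one.1 hX
        refine ⟨{{x}}, ⟨by simp, by simp, by simp, (card_filter_le _ _).trans (by simp)⟩, fun B => ?_⟩
        simp [regionCrossCount, filter_singleton]
    obtain ⟨M, hM, hM0⟩ := hM
    refine ⟨M, hM, ?_⟩
    simp only [hM0, pow_zero, mul_one]
    apply hexp
    positivity
  push Not at hn
  -- choose a pair
  have hpair : ∃ x ∈ X, ∃ y ∈ X, x ≠ y ∧
      ((∑ b, w b * (if ¬ (x ∈ Metric.closedBall (c b) (r b) ↔ y ∈ Metric.closedBall (c b) (r b))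
        then 2 else 1) : ℕ) : ℝ) *
        Real.exp (((min (n - 2) (16 ^ d) : ℕ) : ℝ) * Real.log 2 +
          65 * (d + 2) / (1 - 1 / (d : ℝ)) * ((n - 2 : ℕ) : ℝ) ^ (1 - 1 / (d : ℝ))) ≤
        (∑ b, w b : ℕ) * Real.exp (((min n (16 ^ d) : ℕ) : ℝ) * Real.log 2 +
          65 * (d + 2) / (1 - 1 / (d : ℝ)) * (n : ℝ) ^ (1 - 1 / (d : ℝ))) := by
    have hstep := rpow_step d n hd hn
    set γ := 1 - 1 / (d : ℝ) with hγd
    have hA : 0 < 65 * ((d : ℝ) + 2) / γ := by positivity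
    by_cases hbig : 16 ^ d ≤ n
    · obtain ⟨x, hx, y, hy, hxy, hs⟩ := short_edge hd
        (fun p : (Σ b, Fin (w b)) => c p.1) (fun p => r p.1) (fun p => hr _) X (by rw [hX]; exact hbig)
      refine ⟨x, hx, y, hy, hxy, ?_⟩
      have hc1 : Fintype.card (Σ b, Fin (w b)) = ∑ b, w b := by simp
      have hc2 : (univ.filter fun p : (Σ b, Fin (w b)) =>
          ¬ (dist x (c p.1) ≤ r p.1 ↔ dist y (c p.1) ≤ r p.1)).card =
          ∑ b, w b * (if ¬ (x ∈ Metric.closedBall (c b) (r b) ↔ y ∈ Metric.closedBall (c b) (r b))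
            then 1 else 0) := by
        rw [card_filter, Fintype.sum_sigma]
        refine sum_congr rfl fun b _ => ?_
        simp only [Metric.mem_closedBall, sum_const, card_univ, Fintype.card_fin, smul_eq_mul]
        split_ifs <;> simp
      rw [hc1, hc2, hX] at hs
      have hsum : ∑ b, w b * (if ¬ (x ∈ Metric.closedBall (c b) (r b) ↔
          y ∈ Metric.closedBall (c b) (r b)) then 2 else 1) = ∑ b, w b +
          ∑ b, w b * (if ¬ (x ∈ Metric.closedBall (c b) (r b) ↔ y ∈ Metric.closedBall (c b) (r b))
            then 1 else 0) := by
        rw [← sum_add_distrib]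
        refine sum_congr rfl fun b _ => ?_
        split_ifs <;> ring
      rw [hsum, Nat.cast_add]
      set S : ℝ := ((∑ b, w b : ℕ) : ℝ) with hS
      set D := 130 * ((d : ℝ) + 2) / (n : ℝ) ^ (1 / (d : ℝ)) with hD
      have hS0 : 0 ≤ S := by positivity
      have h1 : S + ((∑ b, w b * (if ¬ (x ∈ Metric.closedBall (c b) (r b) ↔
          y ∈ Metric.closedBall (c b) (r b)) then 1 else 0) : ℕ) : ℝ) ≤ S * Real.exp D := by
        have h2 : S + S * D ≤ S * Real.exp D := by
          have := mul_le_mul_of_nonneg_left (Real.add_one_le_exp D) hS0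
          linarith
        have h3 : 130 * ((d : ℝ) + 2) * S / (n : ℝ) ^ (1 / (d : ℝ)) = S * D := by
          rw [hD]; ring
        rw [h3] at hs
        linarith
      refine (mul_le_mul_of_nonneg_right h1 (Real.exp_pos _).le).trans ?_
      rw [mul_assoc, ← Real.exp_add]
      apply mul_le_mul_of_nonneg_left _ hS0
      apply Real.exp_le_exp.2
      have h4 : ((min (n - 2) (16 ^ d) : ℕ) : ℝ) ≤ ((min n (16 ^ d) : ℕ) : ℝ) := by
        exact_mod_cast min_le_min_right _ (Nat.sub_le n 2)
      have h5 := mul_le_mul_of_nonneg_left hstep hA.le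
      have h6 : 65 * ((d : ℝ) + 2) / γ * (2 * γ / (n : ℝ) ^ (1 / (d : ℝ))) = D := by
        rw [hD]; field_simp; ring
      rw [mul_add, h6] at h5
      have h7 := mul_le_mul_of_nonneg_right h4 hlog2.le
      linarith
    · push Not at hbig
      obtain ⟨x, hx, y, hy, hxy⟩ := one_lt_card.1 (by omega : 1 < X.card)
      refine ⟨x, hx, y, hy, hxy, ?_⟩
      set S : ℝ := ((∑ b, w b : ℕ) : ℝ) with hS
      have hS0 : 0 ≤ S := by positivity
      have h1 : ((∑ b, w b * (if ¬ (x ∈ Metric.closedBall (c b) (r b) ↔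
          y ∈ Metric.closedBall (c b) (r b)) then 2 else 1) : ℕ) : ℝ) ≤
          S * Real.exp (2 * Real.log 2) := by
        have : Real.exp (2 * Real.log 2) = 4 := by
          rw [mul_comm, Real.exp_mul, Real.exp_log (by norm_num)]; norm_num
        rw [this]
        have h2 : ∑ b, w b * (if ¬ (x ∈ Metric.closedBall (c b) (r b) ↔
          y ∈ Metric.closedBall (c b) (r b)) then 2 else 1) ≤ (∑ b, w b) * 4 := by
          rw [sum_mul]
          refine sum_le_sum fun b _ => Nat.mul_le_mul_left _ ?_
          split_ifs <;> norm_num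
        rw [hS]
        exact_mod_cast h2
      refine (mul_le_mul_of_nonneg_right h1 (Real.exp_pos _).le).trans ?_
      rw [mul_assoc, ← Real.exp_add]
      apply mul_le_mul_of_nonneg_left _ hS0
      apply Real.exp_le_exp.2
      rw [min_eq_left hbig.le, min_eq_left (by omega : n - 2 ≤ 16 ^ d), Nat.cast_sub hn] at *
      have h0 : 0 ≤ 2 * γ / (n : ℝ) ^ (1 / (d : ℝ)) := by positivity
      have h5 := mul_le_mul_of_nonneg_left hstep hA.le
      rw [mul_add] at h5
      have h6 := mul_nonneg hA.le h0
      push_cast at *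
      linarith
  obtain ⟨x, hx, y, hy, hxy, hbound⟩ := hpair
  have hcard : ((X.erase x).erase y).card = n - 2 := by
    rw [card_erase_of_mem (mem_erase.2 ⟨hxy.symm, hy⟩), card_erase_of_mem hx, hX]
    omega
  obtain ⟨M, hM, hMb⟩ := ih (n - 2) (by omega) _ hcard (fun b => w b *
    (if ¬ (x ∈ Metric.closedBall (c b) (r b) ↔ y ∈ Metric.closedBall (c b) (r b)) then 2 else 1))
  refine ⟨insert {x, y} M, pm_insert X M x y hx hy hxy hM, ?_⟩
  refine le_trans ?_ (hMb.trans hbound)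
  norm_cast
  apply sum_le_sum
  intro b _
  rw [mul_assoc]
  apply Nat.mul_le_mul_left
  refine (Nat.pow_le_pow_right (by norm_num) (cross_insert M x y _)).trans ?_
  rw [pow_add, mul_comm]
  apply Nat.mul_le_mul_right
  split_ifs <;> norm_num
lemma trace_count {d : ℕ} (X : Finset (EuclideanSpace ℝ (Fin d))) (V : Type) [Fintype V]
    (f : V → EuclideanSpace ℝ (Fin d)) :
    ((univ : Finset (Finset V)).filter fun A => ∃ (c : EuclideanSpace ℝ (Fin d)) (r : ℝ), 0 ≤ r ∧
      ∀ x : V, x ∈ A ↔ dist (f x) c ≤ r).card ≤ (Fintype.card V + 1) ^ (d + 1) := by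
  refine le_trans (card_le_card_shatterer _) (le_trans (card_le_card ?_)
    (card_small_finsets V (d + 1)))
  intro T hT
  rw [mem_shatterer] at hT
  simp only [mem_filter, mem_univ, true_and]
  apply vc_lemma f (fun x => ‖f x‖ ^ 2) T
  intro S hS
  obtain ⟨A, hA, hTA⟩ := hT hS
  simp only [mem_filter, mem_univ, true_and] at hA
  obtain ⟨c, r, hr, h⟩ := hA
  refine ⟨c, ‖c‖ ^ 2 - r ^ 2, fun j hj => ?_⟩
  rw [← hTA, mem_inter, h j, ball_form _ _ _ hr, real_inner_comm, add_comm (‖f j‖ ^ 2)]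
  simp [hj]

lemma cross_congr {V : Type*} [DecidableEq V] (X : Finset V) (M : Finset (Finset V))
    (hM : M.biUnion id = X) (B B' : Set V) (h : ∀ x ∈ X, x ∈ B ↔ x ∈ B') :
    regionCrossCount M B = regionCrossCount M B' := by
  unfold regionCrossCount
  congr 1
  apply filter_congr
  intro e he
  have hs : ∀ x ∈ e, x ∈ X := fun x hx => by
    rw [← hM]; exact mem_biUnion.2 ⟨e, he, hx⟩
  constructor
  · rintro ⟨⟨x, hx, hx'⟩, y, hy, hy'⟩
    exact ⟨⟨x, hx, (h x (hs x hx)).1 hx'⟩, y, hy, fun q => hy' ((h y (hs y hy)).2 q)⟩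
  · rintro ⟨⟨x, hx, hx'⟩, y, hy, hy'⟩
    exact ⟨⟨x, hx, (h x (hs x hx)).2 hx'⟩, y, hy, fun q => hy' ((h y (hs y hy)).1 q)⟩

lemma exists_matching {d : ℕ} (hd : 2 ≤ d) (X : Finset (EuclideanSpace ℝ (Fin d))) :
    ∃ M : Finset (Finset (EuclideanSpace ℝ (Fin d))), IsPerfectMatching X M ∧
      ∀ (ctr : EuclideanSpace ℝ (Fin d)) (r : ℝ), 0 ≤ r →
        (2 : ℝ) ^ regionCrossCount M (Metric.closedBall ctr r) ≤
          ((X.card : ℝ) + 1) ^ (d + 1) * Real.exp (((min X.card (16 ^ d) : ℕ) : ℝ) * Real.log 2 +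
          65 * (d + 2) / (1 - 1 / (d : ℝ)) * (X.card : ℝ) ^ (1 - 1 / (d : ℝ))) := by
  obtain ⟨V, hV, f, hVc, hf, hf2⟩ : ∃ (V : Type) (_ : Fintype V) (f : V → EuclideanSpace ℝ (Fin d)),
      Fintype.card V = X.card ∧ (∀ x ∈ X, ∃ v, f v = x) ∧ ∀ v, f v ∈ X :=
    ⟨X, inferInstance, fun x => x.1, by simp, fun x hx => ⟨⟨x, hx⟩, rfl⟩, fun v => v.2⟩
  have hcount := trace_count X V f
  set F := ((univ : Finset (Finset V)).filter fun A => ∃ (c : EuclideanSpace ℝ (Fin d)) (r : ℝ),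
    0 ≤ r ∧ ∀ x : V, x ∈ A ↔ dist (f x) c ≤ r) with hF
  have hch : ∀ A : F, ∃ (c : EuclideanSpace ℝ (Fin d)) (r : ℝ),
    0 ≤ r ∧ ∀ x : V, x ∈ A.1 ↔ dist (f x) c ≤ r := fun A => (mem_filter.1 A.2).2
  choose c r hr hcr using hch
  obtain ⟨M, hM, hb⟩ := mwu hd c r hr X.card X rfl (fun _ => 1)
  refine ⟨M, hM, fun ctr ρ hρ => ?_⟩
  let A : Finset V := univ.filter fun v => dist (f v) ctr ≤ ρ
  have hA : A ∈ F := by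
    rw [hF, mem_filter]
    exact ⟨mem_univ _, ctr, ρ, hρ, fun x => by simp [A]⟩
  have hcc : regionCrossCount M (Metric.closedBall ctr ρ) =
      regionCrossCount M (Metric.closedBall (c ⟨A, hA⟩) (r ⟨A, hA⟩)) := by
    apply cross_congr X M hM.2.2.1
    intro x hx
    obtain ⟨v, rfl⟩ := hf x hx
    rw [Metric.mem_closedBall, Metric.mem_closedBall, ← hcr ⟨A, hA⟩ v]
    simp [A]
  rw [hcc]
  have h1 : 2 ^ regionCrossCount M (Metric.closedBall (c ⟨A, hA⟩) (r ⟨A, hA⟩)) ≤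
      ∑ b, 1 * 2 ^ regionCrossCount M (Metric.closedBall (c b) (r b)) := by
    simp only [one_mul]
    exact single_le_sum (f := fun b => 2 ^ regionCrossCount M (Metric.closedBall (c b) (r b)))
      (fun _ _ => Nat.zero_le _) (mem_univ (⟨A, hA⟩ : F))
  have h2 : ((∑ b : F, 1 : ℕ) : ℝ) ≤ ((X.card : ℝ) + 1) ^ (d + 1) := by
    rw [hVc] at hcount
    have : ∑ b : F, 1 = F.card := by simp
    rw [this]
    exact_mod_cast hcount
  have h1' : (2 : ℝ) ^ regionCrossCount M (Metric.closedBall (c ⟨A, hA⟩) (r ⟨A, hA⟩)) ≤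
      ((∑ b, 1 * 2 ^ regionCrossCount M (Metric.closedBall (c b) (r b)) : ℕ) : ℝ) := by
    exact_mod_cast h1
  exact (h1'.trans hb).trans (mul_le_mul_of_nonneg_right h2 (Real.exp_pos _).le)

theorem stmt_17 (d : ℕ) (hd : 2 ≤ d) :
    ∃ C : ℝ, ∀ X : Finset (EuclideanSpace ℝ (Fin d)), 2 ≤ X.card →
      ∃ M : Finset (Finset (EuclideanSpace ℝ (Fin d))), IsPerfectMatching X M ∧
        ∀ (ctr : EuclideanSpace ℝ (Fin d)) (r : ℝ), 0 ≤ r →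
          (regionCrossCount M (Metric.closedBall ctr r) : ℝ) ≤
            (6 * ((d : ℝ) + 1) ^ 2 +
                24 * Real.exp 1 * ((d : ℝ) + 2) / ((1 - 1 / (d : ℝ)) ^ 2 * Real.log 2))
              * (X.card : ℝ) ^ (1 - 1 / (d : ℝ))
            + C * Real.log ((d : ℝ) * X.card) * Real.log X.card := by
  refine ⟨(2 * (d + 1) + 16 ^ d) / Real.log 2, fun X hX => ?_⟩
  obtain ⟨M, hM, hb⟩ := exists_matching hd X
  refine ⟨M, hM, fun ctr r hr => ?_⟩
  have h := hb ctr r hr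
  set k := regionCrossCount M (Metric.closedBall ctr r)
  set n : ℕ := X.card
  have hd2 : (2 : ℝ) ≤ d := by exact_mod_cast hd
  have hn2 : (2 : ℝ) ≤ n := by exact_mod_cast hX
  have hinv : 1 / (d : ℝ) ≤ 1 / 2 := one_div_le_one_div_of_le (by norm_num) hd2
  have hinv0 : 0 < 1 / (d : ℝ) := by positivity
  have hL : 0 < Real.log 2 := Real.log_pos (by norm_num)
  set γ := 1 - 1 / (d : ℝ) with hγd
  have hγ : 0 < γ := by linarith
  have hγ1 : γ ≤ 1 := by linarith
  set N := (n : ℝ) ^ γ with hN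
  have hN0 : 0 ≤ N := by positivity
  have hlog := Real.log_le_log (by positivity) h
  rw [Real.log_mul (by positivity) (Real.exp_pos _).ne', Real.log_exp, Real.log_pow,
    Real.log_pow] at hlog
  push_cast at hlog
  have hln2 : Real.log 2 ≤ Real.log n := Real.log_le_log (by norm_num) hn2
  have hln : Real.log ((n : ℝ) + 1) ≤ 2 * Real.log n := by
    have : Real.log ((n : ℝ) + 1) ≤ Real.log ((n : ℝ) ^ 2) :=
      Real.log_le_log (by positivity) (by nlinarith)
    rwa [Real.log_pow] at this
  have hdn : 1 ≤ Real.log ((d : ℝ) * n) := by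
    have h4 : Real.log 4 ≤ Real.log ((d : ℝ) * n) := Real.log_le_log (by norm_num) (by nlinarith)
    have h5 : Real.log 4 = 2 * Real.log 2 := by
      rw [show (4 : ℝ) = 2 ^ 2 by norm_num, Real.log_pow]; norm_num
    have := Real.log_two_gt_d9
    linarith
  have hmin : min (n : ℝ) (16 ^ d) * Real.log 2 ≤ 16 ^ d * Real.log n :=
    mul_le_mul (min_le_right _ _) hln2 hL.le (by positivity)
  have hA : 65 * ((d : ℝ) + 2) / γ ≤ (6 * ((d : ℝ) + 1) ^ 2 +
      24 * Real.exp 1 * ((d : ℝ) + 2) / (γ ^ 2 * Real.log 2)) * Real.log 2 := by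
    have e1 : (6 * ((d : ℝ) + 1) ^ 2 +
      24 * Real.exp 1 * ((d : ℝ) + 2) / (γ ^ 2 * Real.log 2)) * Real.log 2 =
      6 * ((d : ℝ) + 1) ^ 2 * Real.log 2 + 24 * Real.exp 1 * ((d : ℝ) + 2) / γ ^ 2 := by
      field_simp
    rw [e1]
    have h0 : 0 ≤ 6 * ((d : ℝ) + 1) ^ 2 * Real.log 2 := by positivity
    have he := Real.exp_one_gt_d9
    have h6 : 65 * ((d : ℝ) + 2) / γ ≤ 24 * Real.exp 1 * ((d : ℝ) + 2) / γ ^ 2 := by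
      apply div_le_div₀ (by positivity) _ (by positivity) (by nlinarith)
      apply mul_le_mul_of_nonneg_right _ (by positivity)
      linarith
    linarith
  have hA2 := mul_le_mul_of_nonneg_right hA hN0
  have h7 : ((d : ℝ) + 1) * Real.log ((n : ℝ) + 1) ≤ (d + 1) * (2 * Real.log n) :=
    mul_le_mul_of_nonneg_left hln (by positivity)
  have h8 : (2 * ((d : ℝ) + 1) + 16 ^ d) * Real.log n ≤
      (2 * ((d : ℝ) + 1) + 16 ^ d) * Real.log n * Real.log ((d : ℝ) * n) :=
    le_mul_of_one_le_right (by positivity) hdn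
  apply le_of_mul_le_mul_right _ hL
  rw [add_mul]
  have e2 : (2 * ((d : ℝ) + 1) + 16 ^ d) / Real.log 2 * Real.log ((d : ℝ) * n) * Real.log n *
      Real.log 2 = (2 * ((d : ℝ) + 1) + 16 ^ d) * Real.log n * Real.log ((d : ℝ) * n) := by
    field_simp
  rw [e2]
  linarith
end

section
/- Let c > 0 and d > 1 be constants, let (X,S) be a finite set system with n = |X| ≥ 2, m = |S| ≥ 34, m ≥ n, X ∈ S, dual shatter function π*_S(k) ≤ c·k^d for all k, and VC-dimension dvc ≥ 2, and let ε ∈ (0,1). Then there exists a constant C = C(c,d) and a subset A ⊆ X of size at most C·max{ ( dvc·ln(dvc/ε) / ε² )^{d/(d+1)} , dvc·(ln(dvc/ε))^{3/2} / ε } such that A is an ε-approximation of (X,S). -/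
open Finset

lemma edge_aux {α : Type*} [DecidableEq α] (U : Finset α) : ∀ (𝒜 : Finset (Finset α)) (D : ℤ),
    (∀ s, 𝒜.Shatters s → (s.card : ℤ) ≤ D) →
    ∑ i ∈ U, (((𝒜.filter fun A => i ∉ A ∧ insert i A ∈ 𝒜).card : ℕ) : ℤ) ≤ D * 𝒜.card := by
  induction U using Finset.induction_on with
  | empty =>
    intro 𝒜 D h
    rcases 𝒜.eq_empty_or_nonempty with rfl | hne
    · simp
    · have h0 : (0:ℤ) ≤ D := by
        have := h ∅ (shatters_empty.2 hne)
        simpa using this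
      simp only [sum_empty]
      positivity
  | insert a U ha ih =>
    intro 𝒜 D h
    set A0 := 𝒜.nonMemberSubfamily a with hA0
    set A1 := 𝒜.memberSubfamily a with hA1
    have h1 := ih (A0 ∪ A1) D (by
      intro s hs
      apply h
      have has : a ∉ s := by
        intro has
        obtain ⟨u, hu, hsu⟩ := hs (subset_refl s)
        have : a ∈ u := inter_eq_left.1 hsu has
        simp only [hA0, hA1, mem_union, mem_nonMemberSubfamily, mem_memberSubfamily] at hu
        tauto
      intro t ht
      obtain ⟨u, hu, hsu⟩ := hs ht
      simp only [hA0, hA1, mem_union, mem_nonMemberSubfamily, mem_memberSubfamily] at hu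
      rcases hu with hu | hu
      · exact ⟨u, hu.1, hsu⟩
      · exact ⟨insert a u, hu.1, by rw [inter_insert_of_notMem has, hsu]⟩)
    have h2 := ih (A0 ∩ A1) (D - 1) (by
      intro s hs
      have has : a ∉ s := by
        intro has
        obtain ⟨u, hu, hsu⟩ := hs (subset_refl s)
        have : a ∈ u := inter_eq_left.1 hsu has
        simp only [hA0, hA1, mem_inter, mem_nonMemberSubfamily, mem_memberSubfamily] at hu
        tauto
      have := h (insert a s) (by
        intro t ht
        obtain ⟨u, hu, hsu⟩ := hs (t := t.erase a) (by
          intro x hx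
          have := ht (mem_of_mem_erase hx)
          exact (mem_insert.1 this).resolve_left (ne_of_mem_erase hx))
        simp only [hA0, hA1, mem_inter, mem_nonMemberSubfamily, mem_memberSubfamily] at hu
        by_cases hat : a ∈ t
        · refine ⟨insert a u, hu.2.1, ?_⟩
          rw [← insert_inter_distrib, hsu, insert_erase hat]
        · refine ⟨u, hu.1.1, ?_⟩
          rw [insert_inter_of_notMem hu.1.2, hsu, erase_eq_of_notMem hat])
      rw [card_insert_of_notMem has] at this
      push_cast at this
      linarith)
    rw [sum_insert ha]
    have h3 : ((𝒜.filter fun A => a ∉ A ∧ insert a A ∈ 𝒜).card : ℤ) = (A0 ∩ A1).card := by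
      congr 2
      ext u
      simp only [hA0, hA1, mem_filter, mem_inter, mem_nonMemberSubfamily, mem_memberSubfamily]
      tauto
    have h4 : ∀ i ∈ U, ((𝒜.filter fun A => i ∉ A ∧ insert i A ∈ 𝒜).card : ℤ) ≤
        (((A0 ∪ A1).filter fun A => i ∉ A ∧ insert i A ∈ A0 ∪ A1).card : ℤ) +
        (((A0 ∩ A1).filter fun A => i ∉ A ∧ insert i A ∈ A0 ∩ A1).card : ℤ) := by
      intro i hi
      have hia : a ≠ i := fun h => ha (h ▸ hi)
      set E0 := A0.filter fun A => i ∉ A ∧ insert i A ∈ A0 with hE0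
      set E1 := A1.filter fun A => i ∉ A ∧ insert i A ∈ A1 with hE1
      have e1 : (𝒜.filter fun A => i ∉ A ∧ insert i A ∈ 𝒜).card ≤ E0.card + E1.card := by
        have hsub : (𝒜.filter fun A => i ∉ A ∧ insert i A ∈ 𝒜) ⊆ E0 ∪ E1.image (insert a) := by
          intro u hu
          simp only [hE0, hE1, hA0, hA1, mem_filter, mem_union, mem_image,
            mem_nonMemberSubfamily, mem_memberSubfamily] at hu ⊢
          by_cases hau : a ∈ u
          · right
            refine ⟨u.erase a, ⟨⟨by rw [insert_erase hau]; exact hu.1, by simp⟩, ?_, ?_, ?_⟩,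
              insert_erase hau⟩
            · simp [hu.2.1]
            · rw [insert_comm, insert_erase hau]; exact hu.2.2
            · simp [hia]
          · left
            refine ⟨⟨hu.1, hau⟩, hu.2.1, hu.2.2, by simp [hia, hau]⟩
        exact (card_le_card hsub).trans ((card_union_le _ _).trans
          (Nat.add_le_add_left card_image_le _))
      have e2 : E0.card + E1.card = (E0 ∪ E1).card + (E0 ∩ E1).card :=
        (card_union_add_card_inter _ _).symm
      have e3 : (E0 ∪ E1).card ≤ ((A0 ∪ A1).filter fun A => i ∉ A ∧ insert i A ∈ A0 ∪ A1).card := by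
        apply card_le_card
        intro u
        simp only [hE0, hE1, mem_filter, mem_union]
        tauto
      have e4 : (E0 ∩ E1).card ≤ ((A0 ∩ A1).filter fun A => i ∉ A ∧ insert i A ∈ A0 ∩ A1).card := by
        apply card_le_card
        intro u
        simp only [hE0, hE1, mem_filter, mem_inter]
        tauto
      exact_mod_cast (by omega)
    have h5 := sum_le_sum h4
    rw [sum_add_distrib] at h5
    have h6 : ((A0 ∪ A1).card : ℤ) + (A0 ∩ A1).card = 𝒜.card := by
      have := card_union_add_card_inter A0 A1
      have h7 := card_memberSubfamily_add_card_nonMemberSubfamily a 𝒜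
      rw [← hA0, ← hA1] at h7
      exact_mod_cast (by omega)
    rw [h3]
    have : D * 𝒜.card = D * (A0 ∪ A1).card + (D-1) * (A0 ∩ A1).card + (A0 ∩ A1).card := by
      rw [← h6]; ring
    linarith

/-- weighted version -/
lemma edge_weighted {α : Type*} [DecidableEq α] [Fintype α] (μ : Finset α → ℕ) (D : ℕ)
    (h : ∀ s, (univ.filter fun t => 0 < μ t).Shatters s → s.card ≤ D) :
    ∑ i, ∑ t ∈ univ.filter (fun t : Finset α => i ∉ t), min (μ t) (μ (insert i t))
      ≤ D * ∑ t, μ t := by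
  set N := ∑ t, μ t with hN
  have hle : ∀ t, μ t ≤ N := fun t => single_le_sum (f := μ) (fun _ _ => Nat.zero_le _) (mem_univ t)
  have key : ∀ a, a ≤ N → a = ∑ k ∈ range N, if k < a then 1 else 0 := by
    intro a ha
    rw [← sum_filter, ← card_eq_sum_ones]
    have : (range N).filter (fun k => k < a) = range a := by
      ext k; simp; omega
    rw [this, card_range]
  have e1 : ∀ k, ∑ i, ((univ.filter (fun t : Finset α => i ∉ t)).filter
      (fun t => k < min (μ t) (μ (insert i t)))).card ≤ D * (univ.filter fun t => k < μ t).card := by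
    intro k
    have := edge_aux univ (univ.filter fun t => k < μ t) D (by
      intro s hs
      have := h s (hs.mono_left (by
        intro t; simp; omega))
      exact_mod_cast this)
    have h2 : ∑ i, ((univ.filter fun t => k < μ t).filter
      fun A => i ∉ A ∧ insert i A ∈ (univ.filter fun t => k < μ t)).card ≤
        D * (univ.filter fun t => k < μ t).card := by exact_mod_cast this
    refine le_trans (le_of_eq ?_) h2
    refine sum_congr rfl fun i _ => ?_
    congr 1
    ext t
    simp
    tauto
  calc _ = ∑ i, ∑ t ∈ univ.filter (fun t : Finset α => i ∉ t), ∑ k ∈ range N,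
        (if k < min (μ t) (μ (insert i t)) then 1 else 0) := by
        refine sum_congr rfl fun i _ => sum_congr rfl fun t _ => ?_
        exact key _ ((min_le_left _ _).trans (hle t))
    _ = ∑ k ∈ range N, ∑ i, ((univ.filter (fun t : Finset α => i ∉ t)).filter
      (fun t => k < min (μ t) (μ (insert i t)))).card := by
        refine (sum_congr rfl fun i _ => sum_comm).trans ?_
        rw [sum_comm]
        refine sum_congr rfl fun k _ => sum_congr rfl fun i _ => ?_
        rw [card_eq_sum_ones, sum_filter _ (fun _ => 1)]
    _ ≤ ∑ k ∈ range N, D * (univ.filter fun t => k < μ t).card := sum_le_sum fun k _ => e1 k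
    _ = D * ∑ t, μ t := by
        rw [← mul_sum]
        congr 1
        rw [sum_congr rfl fun t _ => key (μ t) (hle t), sum_comm]
        refine sum_congr rfl fun k _ => ?_
        rw [card_eq_sum_ones, sum_filter]

lemma class_lower {V J : Type*} [DecidableEq V] [Fintype J] (p : J → ℝ) (hp : ∀ j, 0 ≤ p j)
    (σ : J → Finset V) (Q : Finset V) (δ : ℝ) (hQ : Q.Nonempty)
    (hsep : ∀ x ∈ Q, ∀ y ∈ Q, x ≠ y → δ ≤ ∑ j, if ¬ (x ∈ σ j ↔ y ∈ σ j) then p j else 0) :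
    δ / 2 * ((Q.card : ℝ) - 1) ≤
      ∑ j, p j * ((min (Q.filter fun x => x ∉ σ j).card (Q.filter fun x => x ∈ σ j).card : ℕ) : ℝ) := by
  have hb : (0:ℝ) < Q.card := by exact_mod_cast hQ.card_pos
  have h1 : ∀ j, ∑ x ∈ Q, ∑ y ∈ Q, (if ¬ (x ∈ σ j ↔ y ∈ σ j) then (1:ℝ) else 0) =
      2 * ((Q.filter fun x => x ∉ σ j).card * (Q.filter fun x => x ∈ σ j).card) := by
    intro j
    have e : ∀ x y, (if ¬ (x ∈ σ j ↔ y ∈ σ j) then (1:ℝ) else 0) =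
        (if x ∉ σ j then 1 else 0) * (if y ∈ σ j then 1 else 0) +
        (if x ∈ σ j then 1 else 0) * (if y ∉ σ j then 1 else 0) := by
      intro x y
      by_cases hx : x ∈ σ j <;> by_cases hy : y ∈ σ j <;> simp [hx, hy]
    simp only [e, sum_add_distrib, ← mul_sum, ← sum_mul, sum_boole]
    ring
  have h2 : ∀ j, 2 * ((Q.filter fun x => x ∉ σ j).card * (Q.filter fun x => x ∈ σ j).card : ℝ) ≤
      2 * Q.card * ((min (Q.filter fun x => x ∉ σ j).card (Q.filter fun x => x ∈ σ j).card : ℕ) : ℝ) := by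
    intro j
    have : (Q.filter fun x => x ∉ σ j).card * (Q.filter fun x => x ∈ σ j).card ≤
        Q.card * min (Q.filter fun x => x ∉ σ j).card (Q.filter fun x => x ∈ σ j).card := by
      rw [← max_mul_min]
      exact Nat.mul_le_mul_right _ (max_le (card_filter_le _ _) (card_filter_le _ _))
    have h3 : ((Q.filter fun x => x ∉ σ j).card * (Q.filter fun x => x ∈ σ j).card : ℝ) ≤
      Q.card * ((min (Q.filter fun x => x ∉ σ j).card (Q.filter fun x => x ∈ σ j).card : ℕ) : ℝ) := by
      exact_mod_cast this
    linarith
  have h3 : ∑ x ∈ Q, ∑ y ∈ Q, (if x ≠ y then δ else 0) = δ * (Q.card * (Q.card - 1)) := by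
    have : ∀ x ∈ Q, ∑ y ∈ Q, (if x ≠ y then δ else 0) = δ * (Q.card - 1) := by
      intro x hx
      have e : ∀ y, (if x ≠ y then δ else 0) = δ - if x = y then δ else 0 := by
        intro y; by_cases h : x = y <;> simp [h]
      simp only [e, sum_sub_distrib, sum_const, sum_ite_eq, hx, if_true, nsmul_eq_mul]
      ring
    rw [sum_congr rfl this, sum_const, nsmul_eq_mul]; ring
  have h4 : δ * (Q.card * (Q.card - 1)) ≤ ∑ j, p j * (2 * Q.card *
      ((min (Q.filter fun x => x ∉ σ j).card (Q.filter fun x => x ∈ σ j).card : ℕ) : ℝ)) := by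
    calc _ ≤ ∑ x ∈ Q, ∑ y ∈ Q, ∑ j, if ¬ (x ∈ σ j ↔ y ∈ σ j) then p j else 0 := by
          rw [← h3]
          refine sum_le_sum fun x hx => sum_le_sum fun y hy => ?_
          by_cases h : x = y
          · simp [h]
          · simpa only [ne_eq, h, not_false_eq_true, if_true] using hsep x hx y hy h
      _ = ∑ j, p j * ∑ x ∈ Q, ∑ y ∈ Q, (if ¬ (x ∈ σ j ↔ y ∈ σ j) then (1:ℝ) else 0) := by
          simp only [mul_sum, mul_ite, mul_one, mul_zero]
          refine (sum_congr rfl fun x _ => sum_comm).trans ?_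
          rw [sum_comm]
      _ ≤ _ := by
          refine sum_le_sum fun j _ => mul_le_mul_of_nonneg_left ?_ (hp j)
          rw [h1]; exact h2 j
  have h5 : ∑ j, p j * (2 * Q.card *
      ((min (Q.filter fun x => x ∉ σ j).card (Q.filter fun x => x ∈ σ j).card : ℕ) : ℝ)) =
      2 * Q.card * ∑ j, p j *
      ((min (Q.filter fun x => x ∉ σ j).card (Q.filter fun x => x ∈ σ j).card : ℕ) : ℝ) := by
    rw [mul_sum]; exact sum_congr rfl fun j _ => by ring
  rw [h5] at h4
  have h6 : (2 * (Q.card:ℝ)) * (δ / 2 * ((Q.card : ℝ) - 1)) ≤ 2 * Q.card * ∑ j, p j *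
      ((min (Q.filter fun x => x ∉ σ j).card (Q.filter fun x => x ∈ σ j).card : ℕ) : ℝ) := by
    refine le_trans (le_of_eq ?_) h4; ring
  exact le_of_mul_le_mul_left h6 (by positivity)

lemma packing {V J : Type*} [DecidableEq V] [Fintype J] (p : J → ℝ) (hp : ∀ j, 0 ≤ p j)
    (hp1 : ∑ j, p j = 1) (σ : J → Finset V) (Q : Finset V) (δ : ℝ) (hδ : 0 ≤ δ) (hQ : Q.Nonempty)
    (hsep : ∀ x ∈ Q, ∀ y ∈ Q, x ≠ y → δ ≤ ∑ j, if ¬ (x ∈ σ j ↔ y ∈ σ j) then p j else 0)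
    (s D : ℕ)
    (hcl : ∀ g : Fin s → J,
      2 * ((Q.image fun x => univ.filter fun k => x ∈ σ (g k)).card : ℝ) ≤ Q.card)
    (hvc : ∀ (f : Fin (s+1) → J) (I : Finset (Fin (s+1))),
      (Q.image fun x => univ.filter fun k => x ∈ σ (f k)).Shatters I → I.card ≤ D) :
    δ * (s + 1 : ℕ) ≤ 4 * D := by
  classical
  have hb : (0:ℝ) < Q.card := by exact_mod_cast hQ.card_pos
  set μ : (Fin (s+1) → J) → Finset (Fin (s+1)) → ℕ := fun f t =>
    (Q.filter fun x => (univ.filter fun k => x ∈ σ (f k)) = t).card with hμ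
  set M : Fin (s+1) → (Fin (s+1) → J) → ℕ := fun i f =>
    ∑ t ∈ univ.filter (fun t : Finset (Fin (s+1)) => i ∉ t), min (μ f t) (μ f (insert i t)) with hM
  have hup : ∀ f, ∑ i, M i f ≤ D * Q.card := by
    intro f
    have h1 := edge_weighted (μ f) D (by
      intro I hI
      apply hvc f I
      refine hI.mono_left ?_
      intro t ht
      simp only [hμ, mem_filter, mem_univ, true_and, card_pos] at ht
      obtain ⟨x, hx⟩ := ht
      rw [mem_filter] at hx
      exact mem_image.2 ⟨x, hx⟩)
    have h2 : ∑ t, μ f t = Q.card := by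
      rw [hμ, ← card_eq_sum_card_fiberwise]
      intro x _; simp
    rw [h2] at h1
    exact h1
  have hprod : ∑ f : Fin (s+1) → J, ∏ k, p (f k) = 1 := by
    rw [← Fintype.piFinset_univ, ← prod_univ_sum]; simp [hp1]
  have hprod' : ∑ f : Fin s → J, ∏ k, p (f k) = 1 := by
    rw [← Fintype.piFinset_univ, ← prod_univ_sum]; simp [hp1]
  have hlow : ∀ i, δ / 4 * Q.card ≤ ∑ f : Fin (s+1) → J, (∏ k, p (f k)) * (M i f : ℝ) := by
    intro i
    have inner : ∀ g : Fin s → J, δ / 4 * Q.card ≤ ∑ j, p j * (M i (Fin.insertNth i j g) : ℝ) := by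
      intro g
      set ρ : V → Finset (Fin (s+1)) := fun x =>
        (univ.filter fun k => x ∈ σ (g k)).image i.succAbove with hρ
      have hiρ : ∀ x, i ∉ ρ x := by
        intro x h
        obtain ⟨k, _, hk⟩ := mem_image.1 h
        exact Fin.succAbove_ne i k hk
      have hτ : ∀ j x, (univ.filter fun k => x ∈ σ ((Fin.insertNth i j g : Fin (s+1) → J) k)) =
          if x ∈ σ j then insert i (ρ x) else ρ x := by
        intro j x
        ext k
        rcases Fin.eq_self_or_eq_succAbove i k with rfl | ⟨k, rfl⟩
        · by_cases hx : x ∈ σ j <;> simp [hx, hiρ]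
        · by_cases hx : x ∈ σ j <;> simp [hx, hρ]
      have hMj : ∀ j, ∑ t ∈ Q.image ρ,
          min ((Q.filter fun x => ρ x = t).filter fun x => x ∉ σ j).card
            ((Q.filter fun x => ρ x = t).filter fun x => x ∈ σ j).card ≤ M i (Fin.insertNth i j g) := by
        intro j
        refine le_trans (le_of_eq ?_) (sum_le_sum_of_subset (s := Q.image ρ) ?_)
        · refine sum_congr rfl fun t ht => ?_
          have hit : i ∉ t := by
            obtain ⟨x, _, rfl⟩ := mem_image.1 ht
            exact hiρ x
          congr 1
          · simp only [hμ]
            congr 1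
            ext x
            simp only [mem_filter, hτ]
            by_cases hx : x ∈ σ j
            · simp only [hx, not_true, and_false, if_true, false_iff, not_and]
              rintro _ rfl
              exact hit (mem_insert_self _ _)
            · simp [hx]
          · simp only [hμ]
            congr 1
            ext x
            simp only [mem_filter, hτ]
            by_cases hx : x ∈ σ j
            · simp only [hx, and_true, if_true]
              refine and_congr_right fun _ => ⟨fun h => by rw [h], fun h => ?_⟩
              rw [← erase_insert (hiρ x), h, erase_insert hit]
            · simp only [hx, and_false, if_false, false_iff, not_and]
              intro _ h
              exact hiρ x (h ▸ mem_insert_self _ _)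
        · intro t ht
          obtain ⟨x, _, rfl⟩ := mem_image.1 ht
          simp [hiρ]
      have hcls : 2 * ((Q.image ρ).card : ℝ) ≤ Q.card := by
        have : (Q.image ρ).card ≤ (Q.image fun x => univ.filter fun k => x ∈ σ (g k)).card := by
          have : Q.image ρ = (Q.image fun x => univ.filter fun k => x ∈ σ (g k)).image
              (fun t => t.image i.succAbove) := by
            rw [image_image]; rfl
          rw [this]; exact card_image_le
        have h2 := hcl g
        have h3 : ((Q.image ρ).card : ℝ) ≤ (Q.image fun x => univ.filter fun k => x ∈ σ (g k)).card := by
          exact_mod_cast this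
        linarith
      calc δ / 4 * Q.card ≤ δ / 2 * (Q.card - (Q.image ρ).card) := by nlinarith
        _ = ∑ t ∈ Q.image ρ, δ / 2 * (((Q.filter fun x => ρ x = t).card : ℝ) - 1) := by
          rw [← mul_sum, sum_sub_distrib]
          congr 2
          · rw [card_eq_sum_card_image ρ Q]; push_cast; rfl
          · simp
        _ ≤ ∑ t ∈ Q.image ρ, ∑ j, p j * ((min ((Q.filter fun x => ρ x = t).filter fun x => x ∉ σ j).card
            ((Q.filter fun x => ρ x = t).filter fun x => x ∈ σ j).card : ℕ) : ℝ) := by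
          refine sum_le_sum fun t ht => ?_
          apply class_lower p hp σ
          · obtain ⟨x, hx, rfl⟩ := mem_image.1 ht
            exact ⟨x, by simp [hx]⟩
          · intro x hx y hy
            exact hsep x (mem_filter.1 hx).1 y (mem_filter.1 hy).1
        _ ≤ _ := by
          rw [sum_comm]
          refine sum_le_sum fun j _ => ?_
          rw [← mul_sum]
          refine mul_le_mul_of_nonneg_left ?_ (hp j)
          exact_mod_cast hMj j
    rw [← (Fin.insertNthEquiv (fun _ => J) i).sum_comp, Fintype.sum_prod_type, sum_comm]
    calc δ / 4 * Q.card = ∑ g : Fin s → J, (∏ k, p (g k)) * (δ / 4 * Q.card) := by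
          rw [← sum_mul, hprod', one_mul]
      _ ≤ ∑ g : Fin s → J, (∏ k, p (g k)) * ∑ j, p j * (M i (Fin.insertNth i j g) : ℝ) :=
          sum_le_sum fun g _ => mul_le_mul_of_nonneg_left (inner g) (prod_nonneg fun _ _ => hp _)
      _ = _ := by
          refine sum_congr rfl fun g _ => ?_
          rw [mul_sum]
          refine sum_congr rfl fun j _ => ?_
          rw [Fin.prod_univ_succAbove _ i]
          simp only [Fin.insertNthEquiv_apply, Fin.insertNth_apply_same, Fin.insertNth_apply_succAbove]
          have e : M i ((Fin.insertNthEquiv (fun _ => J) i) (j, g)) = M i (Fin.insertNth i j g) := rfl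
          rw [e]
          ring
  have hfin : ((s + 1 : ℕ) : ℝ) * (δ / 4 * Q.card) ≤ D * Q.card := by
    calc ((s + 1 : ℕ) : ℝ) * (δ / 4 * Q.card) = ∑ i : Fin (s+1), δ / 4 * Q.card := by simp
      _ ≤ ∑ i, ∑ f : Fin (s+1) → J, (∏ k, p (f k)) * (M i f : ℝ) := sum_le_sum fun i _ => hlow i
      _ = ∑ f : Fin (s+1) → J, (∏ k, p (f k)) * ((∑ i, M i f : ℕ) : ℝ) := by
          rw [sum_comm]; refine sum_congr rfl fun f _ => ?_
          rw [← mul_sum]; push_cast; rfl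
      _ ≤ ∑ f : Fin (s+1) → J, (∏ k, p (f k)) * (D * Q.card) := by
          refine sum_le_sum fun f _ => mul_le_mul_of_nonneg_left ?_ (prod_nonneg fun _ _ => hp _)
          exact_mod_cast hup f
      _ = _ := by rw [← sum_mul, hprod, one_mul]
  have : (δ * (s + 1 : ℕ)) * Q.card ≤ (4 * D) * Q.card := by linarith
  exact le_of_mul_le_mul_right this hb

lemma exists_D (c d : ℝ) : ∃ D : ℕ, ∀ k : ℕ, 1 ≤ k → (2:ℝ)^k ≤ c * (k:ℝ)^d → k ≤ D := by
  have h := (isLittleO_rpow_exp_pos_mul_atTop d (b := Real.log 2) (Real.log_pos (by norm_num))).comp_tendsto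
    tendsto_natCast_atTop_atTop
  have h2 := h.bound (c := 1 / (|c| + 1)) (by positivity)
  rw [Filter.eventually_atTop] at h2
  obtain ⟨D, hD⟩ := h2
  refine ⟨D, fun k hk h3 => ?_⟩
  by_contra hlt
  have h4 := hD k (by omega)
  simp only [Function.comp, Real.norm_eq_abs, Real.abs_exp] at h4
  have e : Real.exp (Real.log 2 * k) = 2 ^ k := by
    rw [Real.exp_mul, Real.exp_log (by norm_num), Real.rpow_natCast]
  have hk0 : (0:ℝ) ≤ (k:ℝ)^d := by positivity
  rw [e, abs_of_nonneg hk0, div_mul_eq_mul_div, le_div_iff₀ (by positivity), one_mul] at h4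
  have h5 : c * (k:ℝ)^d ≤ |c| * (k:ℝ)^d := mul_le_mul_of_nonneg_right (le_abs_self c) hk0
  have h6 : 0 < (k:ℝ)^d := Real.rpow_pos_of_pos (by exact_mod_cast hk) d
  nlinarith

lemma short_edge_s19 (c d : ℝ) (hc : 0 < c) (hd : 1 < d) : ∃ κ : ℝ, 0 < κ ∧
    ∀ (V J : Type) [DecidableEq V] [Fintype J] (σ : J → Finset V) (P : Finset V),
    (∀ (s : ℕ) (f : Fin s → J) (I : Finset (Fin s)), I.Nonempty →
      ((P.image fun x => I.filter fun k => x ∈ σ (f k)).card : ℝ) ≤ c * (I.card : ℝ) ^ d) →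
    ∀ Q ⊆ P, 2 ≤ Q.card → ∀ w : J → ℝ, (∀ j, 0 < w j) →
    ∃ x ∈ Q, ∃ y ∈ Q, x ≠ y ∧ (∑ j, if ¬ (x ∈ σ j ↔ y ∈ σ j) then w j else 0) ≤
      κ * (Q.card : ℝ) ^ (-(1 / d)) * ∑ j, w j := by
  obtain ⟨D, hD⟩ := exists_D c d
  refine ⟨8 * (D + 1) * (2 * c) ^ (1 / d), by positivity, ?_⟩
  intro V J _ _ σ P hdual Q hQP hQ2 w hw
  by_contra hcon
  have hcon : ∀ x ∈ Q, ∀ y ∈ Q, x ≠ y → 8 * (D + 1) * (2 * c) ^ (1 / d) * (Q.card : ℝ) ^ (-(1 / d)) *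
      ∑ j, w j < (∑ j, if ¬ (x ∈ σ j ↔ y ∈ σ j) then w j else 0) := by
    intro x hx y hy hxy
    by_contra h
    exact hcon ⟨x, hx, y, hy, hxy, not_lt.1 h⟩
  have hd0 : 0 < d := by linarith
  have hQ0 : Q.Nonempty := card_pos.1 (by omega)
  have hn : (0:ℝ) < Q.card := by exact_mod_cast hQ0.card_pos
  obtain ⟨x0, hx0, y0, hy0, hxy0⟩ := one_lt_card.1 (show 1 < Q.card by omega)
  set W := ∑ j, w j with hW
  have hW0 : 0 < W := by
    have h1 := hcon x0 hx0 y0 hy0 hxy0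
    by_contra hneg
    have hJ : IsEmpty J := by
      by_contra hJ
      rw [not_isEmpty_iff] at hJ
      exact hneg (sum_pos (fun j _ => hw j) univ_nonempty)
    simp [hW] at h1
  set y := ((Q.card : ℝ) / (2 * c)) ^ (1 / d) with hy
  have hy0' : 0 < y := by positivity
  have hδ : 8 * (D + 1) * (2 * c) ^ (1 / d) * (Q.card : ℝ) ^ (-(1 / d)) = 8 * (D + 1) / y := by
    rw [hy, Real.div_rpow hn.le (by positivity), Real.rpow_neg hn.le]
    field_simp
  rw [hδ] at hcon
  have hsepW : ∀ x y, (∑ j, if ¬ (x ∈ σ j ↔ y ∈ σ j) then w j else 0) ≤ W := by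
    intro x y
    refine sum_le_sum fun j _ => ?_
    have := (hw j).le
    split_ifs
    · exact this
    · exact le_rfl
  have hδ1 : 8 * (D + 1) / y < 1 := by
    have h1 := (hcon x0 hx0 y0 hy0 hxy0).trans_le (hsepW x0 y0)
    by_contra h
    push Not at h
    nlinarith
  have hy8 : 8 * ((D:ℝ) + 1) < y := by rwa [div_lt_one hy0'] at hδ1
  have hD0 : (0:ℝ) ≤ D := Nat.cast_nonneg D
  obtain ⟨s, hs⟩ : ∃ s, ⌊y⌋₊ = s + 1 := by
    refine Nat.exists_eq_succ_of_ne_zero ?_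
    have : 1 ≤ ⌊y⌋₊ := Nat.one_le_floor_iff _ |>.2 (by linarith)
    omega
  have hs1 : ((s + 1 : ℕ) : ℝ) ≤ y := by rw [← hs]; exact Nat.floor_le hy0'.le
  have hs2 : y < ((s + 1 : ℕ) : ℝ) + 1 := by rw [← hs]; exact Nat.lt_floor_add_one y
  have hs3 : 1 ≤ s := by
    have : (1:ℝ) < s := by push_cast at hs2; linarith
    exact_mod_cast this.le
  have hpk := packing (fun j => w j / W) (fun j => div_nonneg (hw j).le hW0.le)
    (by rw [← sum_div]; exact div_self hW0.ne') σ Q (8 * (D + 1) / y) (by positivity) hQ0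
    (by
      intro x hx z hz hxz
      have h1 := hcon x hx z hz hxz
      have : (∑ j, if ¬ (x ∈ σ j ↔ z ∈ σ j) then w j / W else 0) =
        (∑ j, if ¬ (x ∈ σ j ↔ z ∈ σ j) then w j else 0) / W := by
        rw [sum_div]; refine sum_congr rfl fun j _ => ?_
        split_ifs <;> simp
      rw [this, le_div_iff₀ hW0]
      exact h1.le) s D
    (by
      intro g
      have : Nonempty (Fin s) := ⟨⟨0, hs3⟩⟩
      have h1 := hdual s g univ univ_nonempty
      have h2 : ((Q.image fun x => univ.filter fun k => x ∈ σ (g k)).card : ℝ) ≤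
        ((P.image fun x => univ.filter fun k => x ∈ σ (g k)).card : ℝ) := by
        exact_mod_cast card_le_card (image_subset_image hQP)
      have h3 : ((univ : Finset (Fin s)).card : ℝ) ^ d ≤ y ^ d := by
        apply Real.rpow_le_rpow (by positivity) _ hd0.le
        simp only [card_univ, Fintype.card_fin]
        push_cast at hs1; linarith
      have h4 : y ^ d = Q.card / (2 * c) := by
        rw [hy, ← Real.rpow_mul (by positivity), one_div_mul_cancel hd0.ne', Real.rpow_one]
      have h5 : c * ((univ : Finset (Fin s)).card : ℝ) ^ d ≤ c * (Q.card / (2 * c)) := by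
        rw [← h4]; exact mul_le_mul_of_nonneg_left h3 hc.le
      have h6 : c * ((Q.card : ℝ) / (2 * c)) = Q.card / 2 := by field_simp
      linarith)
    (by
      intro f I hI
      by_cases hI0 : I.Nonempty
      · apply hD I.card hI0.card_pos
        refine le_trans ?_ (hdual (s+1) f I hI0)
        have : I.powerset ⊆ (P.image fun x => I.filter fun k => x ∈ σ (f k)) := by
          intro t ht
          obtain ⟨u, hu, hut⟩ := hI (mem_powerset.1 ht)
          obtain ⟨x, hx, rfl⟩ := mem_image.1 hu
          refine mem_image.2 ⟨x, hQP hx, ?_⟩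
          rw [← hut]; ext k; simp
        have h2 := card_le_card this
        rw [card_powerset] at h2
        exact_mod_cast h2
      · rw [not_nonempty_iff_eq_empty.1 hI0]; simp)
  rw [div_mul_eq_mul_div, div_le_iff₀ hy0'] at hpk
  nlinarith

lemma rpow_step_s19 (θ : ℝ) (h0 : 0 < θ) (h1 : θ ≤ 1) (q : ℕ) :
    (q:ℝ) ^ θ + θ * ((q + 1 : ℕ) : ℝ) ^ (θ - 1) ≤ ((q + 1 : ℕ) : ℝ) ^ θ := by
  set i : ℝ := ((q + 1 : ℕ) : ℝ) with hi
  have hi0 : 0 < i := by positivity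
  have hi1 : 1 ≤ i := by rw [hi]; push_cast; linarith [Nat.cast_nonneg (α := ℝ) q]
  have hq : (q:ℝ) = i * (1 + (-(1 / i))) := by
    field_simp; rw [hi]; push_cast; ring
  have hb := rpow_one_add_le_one_add_mul_self (s := -(1 / i)) (by
    rw [neg_le_neg_iff, div_le_one hi0]; exact hi1) h0.le h1
  have hpos : 0 ≤ 1 + (-(1 / i)) := by
    have : 1 / i ≤ 1 := by rw [div_le_one hi0]; exact hi1
    linarith
  rw [hq, Real.mul_rpow hi0.le hpos, Real.rpow_sub_one hi0.ne']
  have h2 : 0 < i ^ θ := Real.rpow_pos_of_pos hi0 θ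
  have h3 := mul_le_mul_of_nonneg_left hb h2.le
  have h4 : i ^ θ * (1 + θ * -(1 / i)) = i ^ θ - θ * (i ^ θ / i) := by ring
  linarith

lemma coloring {V J : Type} [DecidableEq V] [Fintype J] (σ : J → Finset V) (P : Finset V)
    (κ θ : ℝ) (hκ : 0 < κ) (h0 : 0 < θ) (h1 : θ < 1) (lam : ℝ)
    (hse : ∀ Q ⊆ P, 2 ≤ Q.card → ∀ w : J → ℝ, (∀ j, 0 < w j) →
    ∃ x ∈ Q, ∃ y ∈ Q, x ≠ y ∧ (∑ j, if ¬ (x ∈ σ j ↔ y ∈ σ j) then w j else 0) ≤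
      κ * (Q.card : ℝ) ^ (θ - 1) * ∑ j, w j) (q : ℕ) :
    ∀ Q ⊆ P, 2 * q ≤ Q.card → ∀ a b : J → ℝ, (∀ j, 0 < a j) → (∀ j, 0 < b j) →
    ∃ A ⊆ Q, ∃ B ⊆ Q, Disjoint A B ∧ A.card = q ∧ B.card = q ∧
      ∑ j, (a j * Real.exp (lam * (((A ∩ σ j).card : ℝ) - (B ∩ σ j).card)) +
        b j * Real.exp (-(lam * (((A ∩ σ j).card : ℝ) - (B ∩ σ j).card)))) ≤
      (∑ j, (a j + b j)) * Real.exp ((Real.cosh lam - 1) * (κ / θ * (q:ℝ) ^ θ)) := by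
  induction q with
  | zero =>
    intro Q hQ _ a b ha hb
    refine ⟨∅, by simp, ∅, by simp, by simp, by simp, by simp, ?_⟩
    simp [Real.zero_rpow h0.ne']
  | succ q ih =>
    intro Q hQ hcard a b ha hb
    obtain ⟨x, hx, y, hy, hxy, hsep⟩ := hse Q hQ (by omega) (fun j => a j + b j)
      (fun j => add_pos (ha j) (hb j))
    set W := ∑ j, (a j + b j) with hW
    set s : J → ℝ := fun j => (if x ∈ σ j then 1 else 0) - (if y ∈ σ j then 1 else 0) with hs
    have hW0 : 0 ≤ W := sum_nonneg fun j _ => (add_pos (ha j) (hb j)).le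
    have hch : 0 ≤ Real.cosh lam - 1 := by linarith [Real.one_le_cosh lam]
    have hcq : (Q.card : ℝ) ^ (θ - 1) ≤ ((q + 1 : ℕ) : ℝ) ^ (θ - 1) := by
      apply Real.rpow_le_rpow_of_nonpos (by positivity) _ (by linarith)
      exact_mod_cast (by omega)
    set η := (Real.cosh lam - 1) * (κ * ((q + 1 : ℕ) : ℝ) ^ (θ - 1)) with hη
    have hη0 : 0 ≤ η := by positivity
    have hsum : (∑ j, (a j * Real.exp (lam * s j) + b j * Real.exp (-(lam * s j)))) +
        (∑ j, (a j * Real.exp (lam * (- s j)) + b j * Real.exp (-(lam * (- s j))))) ≤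
        2 * (W * (1 + η)) := by
      have e : ∀ j, (a j * Real.exp (lam * s j) + b j * Real.exp (-(lam * s j))) +
        (a j * Real.exp (lam * (- s j)) + b j * Real.exp (-(lam * (- s j)))) =
        2 * (a j + b j) + 2 * (Real.cosh lam - 1) *
          (if ¬ (x ∈ σ j ↔ y ∈ σ j) then a j + b j else 0) := by
        intro j
        rw [Real.cosh_eq]
        by_cases h1 : x ∈ σ j <;> by_cases h2 : y ∈ σ j <;> simp [hs, h1, h2] <;> ring
      rw [← sum_add_distrib, sum_congr rfl fun j _ => e j, sum_add_distrib, ← mul_sum, ← mul_sum]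
      have h3 : (∑ j, if ¬ (x ∈ σ j ↔ y ∈ σ j) then a j + b j else 0) ≤
          κ * ((q + 1 : ℕ) : ℝ) ^ (θ - 1) * W :=
        hsep.trans (mul_le_mul_of_nonneg_right (mul_le_mul_of_nonneg_left hcq hκ.le) hW0)
      have h4 := mul_le_mul_of_nonneg_left h3 hch
      rw [hη]
      nlinarith
    -- general step
    have step : ∀ u v : V, u ∈ Q → v ∈ Q → u ≠ v →
        ∀ s : J → ℝ, (∀ j, s j = (if u ∈ σ j then 1 else 0) - (if v ∈ σ j then 1 else 0)) →
        ∑ j, (a j * Real.exp (lam * s j) + b j * Real.exp (-(lam * s j))) ≤ W * (1 + η) →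
        ∃ A ⊆ Q, ∃ B ⊆ Q, Disjoint A B ∧ A.card = q + 1 ∧ B.card = q + 1 ∧
        ∑ j, (a j * Real.exp (lam * (((A ∩ σ j).card : ℝ) - (B ∩ σ j).card)) +
          b j * Real.exp (-(lam * (((A ∩ σ j).card : ℝ) - (B ∩ σ j).card)))) ≤
        W * Real.exp ((Real.cosh lam - 1) * (κ / θ * ((q + 1 : ℕ):ℝ) ^ θ)) := by
      intro u v hu hv huv s hs hle
      obtain ⟨A, hA, B, hB, hAB, hAc, hBc, hbd⟩ := ih ((Q.erase u).erase v)
        ((erase_subset _ _).trans ((erase_subset _ _).trans hQ)) (by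
          rw [card_erase_of_mem (mem_erase.2 ⟨huv.symm, hv⟩), card_erase_of_mem hu]; omega)
        (fun j => a j * Real.exp (lam * s j)) (fun j => b j * Real.exp (-(lam * s j)))
        (fun j => mul_pos (ha j) (Real.exp_pos _)) (fun j => mul_pos (hb j) (Real.exp_pos _))
      have hQQ : (Q.erase u).erase v ⊆ Q := (erase_subset _ _).trans (erase_subset _ _)
      have huA : u ∉ A := fun h => by have := hA h; simp at this
      have huB : u ∉ B := fun h => by have := hB h; simp at this
      have hvA : v ∉ A := fun h => by have := hA h; simp at this
      have hvB : v ∉ B := fun h => by have := hB h; simp at this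
      refine ⟨insert u A, insert_subset hu (hA.trans hQQ), insert v B,
        insert_subset hv (hB.trans hQQ), ?_, by rw [card_insert_of_notMem huA, hAc],
        by rw [card_insert_of_notMem hvB, hBc], ?_⟩
      · rw [disjoint_insert_left, disjoint_insert_right]
        refine ⟨?_, hvA, hAB⟩
        simp [huv, huB]
      · have hcA : ∀ j, (((insert u A) ∩ σ j).card : ℝ) = (A ∩ σ j).card + if u ∈ σ j then 1 else 0 := by
          intro j
          by_cases h : u ∈ σ j
          · rw [insert_inter_of_mem h, card_insert_of_notMem (by simp [huA])]; simp [h]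
          · rw [insert_inter_of_notMem h]; simp [h]
        have hcB : ∀ j, (((insert v B) ∩ σ j).card : ℝ) = (B ∩ σ j).card + if v ∈ σ j then 1 else 0 := by
          intro j
          by_cases h : v ∈ σ j
          · rw [insert_inter_of_mem h, card_insert_of_notMem (by simp [hvB])]; simp [h]
          · rw [insert_inter_of_notMem h]; simp [h]
        have hdiff : ∀ j, (((insert u A) ∩ σ j).card : ℝ) - ((insert v B) ∩ σ j).card =
            s j + (((A ∩ σ j).card : ℝ) - (B ∩ σ j).card) := by
          intro j; rw [hcA, hcB, hs]; ring
        have hL : ∑ j, (a j * Real.exp (lam * ((((insert u A) ∩ σ j).card : ℝ) - ((insert v B) ∩ σ j).card)) +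
          b j * Real.exp (-(lam * ((((insert u A) ∩ σ j).card : ℝ) - ((insert v B) ∩ σ j).card)))) =
          ∑ j, (a j * Real.exp (lam * s j) * Real.exp (lam * (((A ∩ σ j).card : ℝ) - (B ∩ σ j).card)) +
        b j * Real.exp (-(lam * s j)) * Real.exp (-(lam * (((A ∩ σ j).card : ℝ) - (B ∩ σ j).card)))) := by
          refine sum_congr rfl fun j _ => ?_
          rw [hdiff, mul_assoc, mul_assoc, ← Real.exp_add, ← Real.exp_add]
          congr 3 <;> ring_nf
        rw [hL]
        refine hbd.trans ?_
        refine (mul_le_mul_of_nonneg_right hle (Real.exp_pos _).le).trans ?_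
        rw [mul_assoc]
        refine mul_le_mul_of_nonneg_left ?_ hW0
        have h1η : 1 + η ≤ Real.exp η := by linarith [Real.add_one_le_exp η]
        refine (mul_le_mul_of_nonneg_right h1η (Real.exp_pos _).le).trans ?_
        rw [← Real.exp_add, Real.exp_le_exp, hη, ← mul_add]
        refine mul_le_mul_of_nonneg_left ?_ hch
        have := mul_le_mul_of_nonneg_left (rpow_step_s19 θ h0 h1.le q) (show 0 ≤ κ / θ by positivity)
        refine le_trans (le_of_eq ?_) this
        field_simp
        ring
    by_cases hcase : ∑ j, (a j * Real.exp (lam * s j) + b j * Real.exp (-(lam * s j))) ≤ W * (1 + η)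
    · exact step x y hx hy hxy s (fun j => rfl) hcase
    · exact step y x hy hx hxy.symm (fun j => - s j) (fun j => by simp [hs]) (by linarith)

lemma disc {V J : Type} [DecidableEq V] [Fintype J] (σ : J → Finset V) (P : Finset V)
    (κ θ : ℝ) (hκ : 0 < κ) (h0 : 0 < θ) (h1 : θ < 1)
    (hse : ∀ Q ⊆ P, 2 ≤ Q.card → ∀ w : J → ℝ, (∀ j, 0 < w j) →
    ∃ x ∈ Q, ∃ y ∈ Q, x ≠ y ∧ (∑ j, if ¬ (x ∈ σ j ↔ y ∈ σ j) then w j else 0) ≤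
      κ * (Q.card : ℝ) ^ (θ - 1) * ∑ j, w j) (q : ℕ) (hq : 2 * q ≤ P.card) (l : ℝ) (hl0 : 0 < l)
      (hl : Real.log (2 * Fintype.card J) ≤ l) :
    ∃ A ⊆ P, ∃ B ⊆ P, Disjoint A B ∧ A.card = q ∧ B.card = q ∧
      ∀ j, |((A ∩ σ j).card : ℝ) - (B ∩ σ j).card| ≤ 2 * Real.sqrt (l * (κ / θ * (q:ℝ) ^ θ)) + 2 * l := by
  set K := κ / θ * (q:ℝ) ^ θ with hK
  have hK0 : 0 ≤ K := by positivity
  set lam := Real.sqrt (l / (K + l)) with hlam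
  have hKl : 0 < K + l := by linarith
  have hlam0 : 0 < lam := Real.sqrt_pos.2 (by positivity)
  have hlamsq : lam ^ 2 = l / (K + l) := Real.sq_sqrt (by positivity)
  have hlam1 : lam ^ 2 ≤ 1 := by rw [hlamsq, div_le_one hKl]; linarith
  obtain ⟨A, hA, B, hB, hAB, hAc, hBc, hbd⟩ := coloring σ P κ θ hκ h0 h1 lam hse q P subset_rfl hq
    (fun _ => 1) (fun _ => 1) (fun _ => one_pos) (fun _ => one_pos)
  refine ⟨A, hA, B, hB, hAB, hAc, hBc, fun j => ?_⟩
  set Dj := ((A ∩ σ j).card : ℝ) - (B ∩ σ j).card with hD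
  have hcosh : Real.cosh lam - 1 ≤ lam ^ 2 := by
    have h2 := Real.cosh_le_exp_half_sq lam
    have h3 := Real.abs_exp_sub_one_sub_id_le (x := lam ^ 2 / 2) (by
      rw [abs_of_nonneg (by positivity)]; linarith)
    have h4 := (abs_le.1 h3).2
    nlinarith [sq_nonneg lam]
  have hnn : ∀ j, 0 ≤ (1:ℝ) * Real.exp (lam * (((A ∩ σ j).card : ℝ) - (B ∩ σ j).card)) +
        1 * Real.exp (-(lam * (((A ∩ σ j).card : ℝ) - (B ∩ σ j).card))) := fun j => by positivity
  have hs := (single_le_sum (fun j _ => hnn j) (mem_univ j)).trans hbd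
  rw [← hD] at hs
  have habs : Real.exp (lam * |Dj|) ≤ 1 * Real.exp (lam * Dj) + 1 * Real.exp (-(lam * Dj)) := by
    rcases abs_cases Dj with h | h
    · rw [h.1]; linarith [Real.exp_pos (-(lam * Dj))]
    · rw [h.1, mul_neg]; linarith [Real.exp_pos (lam * Dj)]
  have hcardpos : (0:ℝ) < 2 * Fintype.card J := by
    have : 0 < Fintype.card J := Fintype.card_pos_iff.2 ⟨j⟩
    positivity
  have hsumc : ∑ _j : J, ((1:ℝ) + 1) = 2 * Fintype.card J := by simp; ring
  rw [hsumc] at hs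
  have h5 : Real.exp (lam * |Dj|) ≤ Real.exp (l + lam ^ 2 * K) := by
    refine (habs.trans hs).trans ?_
    rw [Real.exp_add]
    refine mul_le_mul ?_ ?_ (Real.exp_pos _).le (Real.exp_pos _).le
    · rw [← Real.log_le_iff_le_exp hcardpos]; exact hl
    · rw [Real.exp_le_exp]
      exact mul_le_mul_of_nonneg_right hcosh hK0
  rw [Real.exp_le_exp] at h5
  have h6 : lam ^ 2 * (K + l) = l := by rw [hlamsq]; field_simp
  -- |D| lam <= 2 lam^2 (K+l)
  have h7 : |Dj| ≤ 2 * (lam * (K + l)) := by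
    have : lam * |Dj| ≤ lam * (2 * (lam * (K + l))) := by nlinarith
    exact le_of_mul_le_mul_left this hlam0
  have h8 : lam * (K + l) = Real.sqrt (l * K + l ^ 2) := by
    symm
    rw [Real.sqrt_eq_iff_mul_self_eq (by positivity) (by positivity)]
    have : lam * (K + l) * (lam * (K + l)) = (lam ^ 2 * (K + l)) * (K + l) := by ring
    rw [this, h6]; ring
  have h9 : Real.sqrt (l * K + l ^ 2) ≤ Real.sqrt (l * K) + l := by
    rw [Real.sqrt_le_iff]
    refine ⟨by positivity, ?_⟩
    have h10 := Real.sq_sqrt (show 0 ≤ l * K by positivity)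
    have h11 := Real.sqrt_nonneg (l * K)
    nlinarith
  rw [h8] at h7
  linarith

lemma sauer {V : Type} [DecidableEq V] (P : Finset V) (𝒜 : Finset (Finset V)) (D : ℕ)
    (hP : ∀ A ∈ 𝒜, A ⊆ P) (h : ∀ s, 𝒜.Shatters s → s.card ≤ D) :
    𝒜.card ≤ (P.card + 1) ^ D := by
  have hsub : 𝒜.shatterer ⊆ (range (D + 1)).biUnion fun k => P.powersetCard k := by
    intro s hs
    rw [mem_shatterer] at hs
    obtain ⟨t, ht, hst⟩ := hs.exists_superset
    simp only [mem_biUnion, mem_range, mem_powersetCard]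
    exact ⟨s.card, Nat.lt_succ_of_le (h s hs), hst.trans (hP t ht), rfl⟩
  refine (card_le_card_shatterer 𝒜).trans ((card_le_card hsub).trans (card_biUnion_le.trans ?_))
  rw [add_pow]
  refine sum_le_sum fun k hk => ?_
  rw [card_powersetCard, one_pow, mul_one]
  have h1 : 1 ≤ D.choose k := Nat.choose_pos (Nat.lt_succ_iff.1 (mem_range.1 hk))
  exact (Nat.choose_le_pow _ _).trans (Nat.le_mul_of_pos_right _ h1)

lemma err_arith (a b t q r : ℝ) (ht0 : 0 ≤ t) (htr : t ≤ r) (hr : r ≤ 1) (hq : 0 < q)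
    (ha : 0 ≤ a) (hb : 0 ≤ b) (haq : a ≤ q) (hbq : b ≤ q) :
    |(a + b + t) / (2 * q + r) - a / q| ≤ (|a - b| + 1) / (2 * q) := by
  have hN : 0 < 2 * q + r := by linarith
  set z := (a + b + t) / (2 * q + r) with hz
  have hz0 : 0 ≤ z := by positivity
  have hz1 : z ≤ 1 := by rw [hz, div_le_one hN]; linarith
  have hzN : z * (2 * q + r) = a + b + t := by rw [hz]; field_simp
  have e : z - a / q = (-(z * r) + t - (a - b)) / (2 * q) := by
    field_simp; linarith
  rw [e, abs_div, abs_of_pos (show 0 < 2 * q by linarith)]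
  apply div_le_div_of_nonneg_right _ (by linarith)
  have h1 : z * r ≤ 1 := by nlinarith
  have h2 : 0 ≤ z * r := by nlinarith
  rw [abs_le]
  have := le_abs_self (a - b)
  have := neg_abs_le (a - b)
  constructor <;> linarith

lemma halving (c d : ℝ) (hc : 0 < c) (hd : 1 < d) : ∃ κ : ℝ, 0 < κ ∧
    ∀ (V : Type) [DecidableEq V], ∀ (X : Finset V) (𝒮 : Finset (Finset V)),
      (∀ R ⊆ 𝒮, R.Nonempty →
        ((X.image fun x => R.filter fun r => x ∈ r).card : ℝ) ≤ c * (R.card : ℝ) ^ d) →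
      ∀ dvc : ℕ, 2 ≤ dvc →
      (∀ Y ⊆ X, (∀ Z ⊆ Y, ∃ S ∈ 𝒮, S ∩ Y = Z) → Y.card ≤ dvc) →
      ∀ P ⊆ X, ∀ q r : ℕ, 2 ≤ q → r ≤ 1 → P.card = 2 * q + r →
      ∃ Q ⊆ P, Q.card = q ∧ ∀ S ∈ 𝒮,
        |((P ∩ S).card : ℝ) / P.card - ((Q ∩ S).card : ℝ) / Q.card| ≤
          (Real.sqrt (4 * dvc * Real.log q * (κ * (q:ℝ) ^ (1 - 1 / d))) + 2 * (4 * dvc * Real.log q)) / q := by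
  obtain ⟨κ, hκ, hshort⟩ := short_edge_s19 c d hc hd
  have hd0 : 0 < d := by linarith
  have hθ0 : 0 < 1 - 1 / d := by
    have : 1 / d < 1 := by rw [div_lt_one hd0]; exact hd
    linarith
  have hθ1 : 1 - 1 / d < 1 := by
    have : 0 < 1 / d := by positivity
    linarith
  refine ⟨κ / (1 - 1 / d), by positivity, ?_⟩
  intro V _ X 𝒮 hdual dvc hdvc hvc P hPX q r hq hr hcard
  set F := 𝒮.image (fun S => S ∩ P) with hF
  have hlift : ∀ j : F, ∃ S ∈ 𝒮, S ∩ P = j.1 := fun j => mem_image.1 j.2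
  choose L hL1 hL2 using hlift
  have hmemL : ∀ x ∈ P, ∀ j : F, x ∈ j.1 ↔ x ∈ L j := by
    intro x hx j
    rw [← hL2 j, mem_inter]; tauto
  have hdualP : ∀ (s : ℕ) (f : Fin s → F) (I : Finset (Fin s)), I.Nonempty →
      ((P.image fun x => I.filter fun k => x ∈ (fun j : F => j.1) (f k)).card : ℝ) ≤
        c * (I.card : ℝ) ^ d := by
    intro s f I hI
    set R := I.image (fun k => L (f k)) with hR
    have h1 := hdual R (by
      intro S hS
      obtain ⟨k, _, rfl⟩ := mem_image.1 hS
      exact hL1 _) (hI.image _)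
    have h2 : (P.image fun x => I.filter fun k => x ∈ (fun j : F => j.1) (f k)) ⊆
        (X.image fun x => R.filter fun r => x ∈ r).image (fun T => I.filter fun k => L (f k) ∈ T) := by
      intro T hT
      obtain ⟨x, hx, rfl⟩ := mem_image.1 hT
      refine mem_image.2 ⟨_, mem_image_of_mem _ (hPX hx), ?_⟩
      ext k
      simp only [mem_filter, hR, mem_image, hmemL x hx]
      constructor
      · rintro ⟨hk, _, h⟩; exact ⟨hk, h⟩
      · rintro ⟨hk, h⟩; exact ⟨hk, ⟨k, hk, rfl⟩, h⟩
    have h3 : ((P.image fun x => I.filter fun k => x ∈ (fun j : F => j.1) (f k)).card : ℝ) ≤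
        ((X.image fun x => R.filter fun r => x ∈ r).card : ℝ) := by
      exact_mod_cast (card_le_card h2).trans card_image_le
    have h4 : (R.card : ℝ) ^ d ≤ (I.card : ℝ) ^ d := by
      apply Real.rpow_le_rpow (by positivity) _ hd0.le
      exact_mod_cast card_image_le
    exact h3.trans (h1.trans (mul_le_mul_of_nonneg_left h4 hc.le))
  have hse := hshort V F (fun j => j.1) P hdualP
  have hFc : F.card ≤ (P.card + 1) ^ dvc := by
    apply sauer P F dvc
    · intro A hA
      obtain ⟨S, _, rfl⟩ := mem_image.1 hA
      exact inter_subset_right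
    · intro s hs
      have hsP : s ⊆ P := by
        obtain ⟨u, hu, hsu⟩ := hs.exists_superset
        obtain ⟨S, _, rfl⟩ := mem_image.1 hu
        exact hsu.trans inter_subset_right
      apply hvc s (hsP.trans hPX)
      intro Z hZ
      obtain ⟨u, hu, hsu⟩ := hs hZ
      obtain ⟨S, hS, rfl⟩ := mem_image.1 hu
      refine ⟨S, hS, ?_⟩
      rw [← hsu]
      ext x
      simp only [mem_inter]
      constructor
      · rintro ⟨h1, h2⟩; exact ⟨h2, h1, hsP h2⟩
      · rintro ⟨h1, h2, h3⟩; exact ⟨h2, h1⟩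
  have hF2 : 2 * F.card ≤ q ^ (4 * dvc) := by
    have h1 : P.card + 1 ≤ q ^ 3 := by
      have : 2 * q + 2 ≤ q ^ 3 := by nlinarith [sq_nonneg (q:ℤ), Nat.mul_le_mul hq hq]
      omega
    have h2 : 2 ≤ q ^ dvc := by
      calc 2 ≤ q := hq
        _ = q ^ 1 := (pow_one q).symm
        _ ≤ q ^ dvc := Nat.pow_le_pow_right (by omega) (by omega)
    calc 2 * F.card ≤ q ^ dvc * (q ^ 3) ^ dvc :=
          Nat.mul_le_mul h2 (hFc.trans (Nat.pow_le_pow_left h1 _))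
      _ = q ^ (4 * dvc) := by rw [← pow_mul, ← pow_add]; congr 1; ring
  have hlogq : Real.log 2 ≤ Real.log q := Real.log_le_log (by norm_num) (by exact_mod_cast hq)
  have hlog2 := Real.log_two_gt_d9
  have hdvcR : (2:ℝ) ≤ dvc := by exact_mod_cast hdvc
  set l := 4 * dvc * Real.log q with hl
  have hl1 : 1 ≤ l := by rw [hl]; nlinarith
  have hlF : Real.log (2 * Fintype.card F) ≤ l := by
    rcases Nat.eq_zero_or_pos (Fintype.card F) with h0 | h0
    · rw [h0]; simp; linarith
    · have h1 : (0:ℝ) < 2 * Fintype.card F := by positivity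
      have h2 : (2 * Fintype.card F : ℝ) ≤ (q:ℝ) ^ (4 * dvc) := by
        rw [Fintype.card_coe]; exact_mod_cast hF2
      refine (Real.log_le_log h1 h2).trans (le_of_eq ?_)
      rw [Real.log_pow, hl]; push_cast; ring
  obtain ⟨A, hA, B, hB, hAB, hAc, hBc, hdisc⟩ := disc (fun j : F => j.1) P κ (1 - 1 / d) hκ hθ0 hθ1
    (by
      intro Q hQ hQ2 w hw
      have := hse Q hQ hQ2 w hw
      rwa [show 1 - 1 / d - 1 = -(1 / d) by ring]) q (by omega) l (by linarith) hlF
  refine ⟨A, hA, hAc, fun S hS => ?_⟩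
  have hD := hdisc ⟨S ∩ P, mem_image_of_mem _ hS⟩
  have hAS : A ∩ (S ∩ P) = A ∩ S := by
    ext x; simp only [mem_inter]; have := @hA x; tauto
  have hBS : B ∩ (S ∩ P) = B ∩ S := by
    ext x; simp only [mem_inter]; have := @hB x; tauto
  simp only [hAS, hBS] at hD
  set T := P \ (A ∪ B) with hT
  have hTc : T.card = r := by
    rw [hT, card_sdiff_of_subset (union_subset hA hB), card_union_of_disjoint hAB]; omega
  have hPS : (P ∩ S).card = (A ∩ S).card + (B ∩ S).card + (T ∩ S).card := by
    have e : P ∩ S = ((A ∩ S) ∪ (B ∩ S)) ∪ (T ∩ S) := by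
      ext x; simp only [hT, mem_inter, mem_union, mem_sdiff]
      have := @hA x; have := @hB x; tauto
    rw [e, card_union_of_disjoint, card_union_of_disjoint]
    · exact hAB.mono inter_subset_left inter_subset_left
    · rw [← union_inter_distrib_right]
      exact disjoint_sdiff.mono inter_subset_left inter_subset_left
  have hqpos : (0:ℝ) < q := by positivity
  have := err_arith (A ∩ S).card (B ∩ S).card (T ∩ S).card q r (by positivity)
    (by rw [← hTc]; exact_mod_cast card_le_card inter_subset_left) (by exact_mod_cast hr) hqpos
    (by positivity) (by positivity)
    (by rw [← hAc]; exact_mod_cast card_le_card inter_subset_left)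
    (by rw [← hBc]; exact_mod_cast card_le_card inter_subset_left)
  rw [hPS, hcard, hAc]
  push_cast
  refine this.trans ?_
  rw [div_le_div_iff₀ (by positivity) hqpos]
  nlinarith

lemma decay (T q v κ θ : ℝ) (hT : 3 ≤ T) (hq : T ≤ q) (hv : 0 ≤ v) (hκ : 0 < κ) (hθ0 : 0 < θ)
    (hθ1 : θ < 1) :
    (Real.sqrt (4 * v * Real.log q * (κ * q ^ θ)) + 2 * (4 * v * Real.log q)) / q ≤
      (T / q) ^ ((1:ℝ) / 4) *
        ((Real.sqrt (8 * v * Real.log T * (κ * T ^ θ)) + 16 * v * Real.log T) / T) := by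
  have hT0 : 0 < T := by linarith
  have hq0 : 0 < q := by linarith
  set L := Real.log T with hL
  have hL1 : 1 ≤ L := by
    rw [hL, Real.le_log_iff_exp_le hT0]
    linarith [Real.exp_one_lt_d9]
  set u := (q / T) ^ ((1:ℝ) / 4) with hu
  have hqT : 1 ≤ q / T := by rw [le_div_iff₀ hT0]; linarith
  have hu1 : 1 ≤ u := Real.one_le_rpow hqT (by norm_num)
  have hu0 : 0 < u := by linarith
  have hu4 : u ^ 4 = q / T := by
    rw [hu, ← Real.rpow_natCast, ← Real.rpow_mul (by positivity)]; norm_num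
  have hqu : q = T * u ^ 4 := by rw [hu4]; field_simp
  have hinv : (T / q) ^ ((1:ℝ) / 4) = 1 / u := by
    rw [hu, ← inv_div, Real.inv_rpow (by positivity), one_div ((q / T) ^ ((1:ℝ) / 4))]
  have hlog : Real.log q ≤ 2 * L * u ^ 2 := by
    have h1 : Real.log q = L + 2 * Real.log (u ^ 2) := by
      rw [hqu, Real.log_mul hT0.ne' (by positivity), Real.log_pow, Real.log_pow]; push_cast; ring
    have h2 := Real.log_le_sub_one_of_pos (show 0 < u ^ 2 by positivity)
    have h3 : 1 ≤ u ^ 2 := one_le_pow₀ hu1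
    rw [h1]; nlinarith
  have hlogq0 : 0 ≤ Real.log q := Real.log_nonneg (by linarith)
  have hqθ : q ^ θ ≤ T ^ θ * u ^ 4 := by
    rw [hqu, Real.mul_rpow hT0.le (by positivity)]
    refine mul_le_mul_of_nonneg_left ?_ (by positivity)
    calc (u ^ 4) ^ θ ≤ (u ^ 4) ^ (1:ℝ) :=
          Real.rpow_le_rpow_of_exponent_le (one_le_pow₀ hu1) hθ1.le
      _ = u ^ 4 := Real.rpow_one _
  have hs : Real.sqrt (4 * v * Real.log q * (κ * q ^ θ)) ≤
      Real.sqrt (8 * v * L * (κ * T ^ θ)) * u ^ 3 := by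
    have h1 : 4 * v * Real.log q * (κ * q ^ θ) ≤ (8 * v * L * (κ * T ^ θ)) * (u ^ 3) ^ 2 := by
      calc 4 * v * Real.log q * (κ * q ^ θ) ≤ 4 * v * (2 * L * u ^ 2) * (κ * (T ^ θ * u ^ 4)) := by
            gcongr
        _ = _ := by ring
    refine (Real.sqrt_le_sqrt h1).trans (le_of_eq ?_)
    rw [Real.sqrt_mul' _ (by positivity), Real.sqrt_sq (by positivity)]
  rw [hinv]
  have hu23 : u ^ 2 ≤ u ^ 3 := pow_le_pow_right₀ hu1 (by norm_num)
  have h8 : 2 * (4 * v * Real.log q) ≤ 16 * v * L * u ^ 3 := by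
    calc 2 * (4 * v * Real.log q) ≤ 2 * (4 * v * (2 * L * u ^ 2)) := by gcongr
      _ = 16 * v * L * u ^ 2 := by ring
      _ ≤ _ := by gcongr
  rw [div_le_iff₀ hq0]
  have e : 1 / u * ((Real.sqrt (8 * v * L * (κ * T ^ θ)) + 16 * v * L) / T) * q =
      Real.sqrt (8 * v * L * (κ * T ^ θ)) * u ^ 3 + 16 * v * L * u ^ 3 := by
    rw [hqu]; field_simp
  rw [e]; linarith

lemma iterate {V : Type} [DecidableEq V] (X : Finset V) (𝒮 : Finset (Finset V)) (T : ℕ) (hT : 3 ≤ T)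
    (E : ℝ) (hE : 0 ≤ E)
    (hh : ∀ P ⊆ X, ∀ q r : ℕ, T ≤ q → r ≤ 1 → P.card = 2 * q + r →
      ∃ Q ⊆ P, Q.card = q ∧ ∀ S ∈ 𝒮,
        |((P ∩ S).card : ℝ) / P.card - ((Q ∩ S).card : ℝ) / Q.card| ≤
          ((T:ℝ) / q) ^ ((1:ℝ) / 4) * E) (N : ℕ) :
    ∀ P ⊆ X, P.card = N → T ≤ N → ∃ A ⊆ P, A.card ≤ 2 * T ∧ ∀ S ∈ 𝒮,
      |((P ∩ S).card : ℝ) / P.card - ((A ∩ S).card : ℝ) / A.card| ≤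
        7 * E * (1 - ((T:ℝ) / N) ^ ((1:ℝ) / 4)) := by
  have hT0 : (0:ℝ) < T := by positivity
  induction N using Nat.strong_induction_on with
  | _ N ih =>
    intro P hP hPN hTN
    have hN0 : (0:ℝ) < N := by
      have : 0 < N := by omega
      exact_mod_cast this
    by_cases hbig : 2 * T ≤ N
    · obtain ⟨Q, hQ, hQc, hQe⟩ := hh P hP (N / 2) (N % 2) (by omega) (by omega) (by omega)
      obtain ⟨A, hA, hAc, hAe⟩ := ih (N / 2) (by omega) Q (hQ.trans hP) hQc (by omega)
      refine ⟨A, hA.trans hQ, hAc, fun S hS => ?_⟩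
      have h1 := hQe S hS
      have h2 := hAe S hS
      have hq0 : (0:ℝ) < (N / 2 : ℕ) := by
        have : 0 < N / 2 := by omega
        exact_mod_cast this
      have hNq : 2 * ((N / 2 : ℕ) : ℝ) ≤ N := by
        have : 2 * (N / 2) ≤ N := by omega
        exact_mod_cast this
      have h3 : ((T:ℝ) / N) ^ ((1:ℝ) / 4) ≤ 6 / 7 * ((T:ℝ) / (N / 2 : ℕ)) ^ ((1:ℝ) / 4) := by
        have e1 : (6 / 7 : ℝ) = ((6 / 7 : ℝ) ^ 4) ^ ((1:ℝ) / 4) := by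
          rw [← Real.rpow_natCast, ← Real.rpow_mul (by norm_num)]; norm_num
        rw [e1, ← Real.mul_rpow (by norm_num) (by positivity)]
        apply Real.rpow_le_rpow (by positivity) _ (by norm_num)
        rw [mul_div_assoc', div_le_div_iff₀ hN0 hq0]
        have := mul_le_mul_of_nonneg_left hNq hT0.le
        have : 0 ≤ (T:ℝ) * (N / 2 : ℕ) := by positivity
        nlinarith
      refine (abs_sub_le _ (((Q ∩ S).card : ℝ) / Q.card) _).trans ?_
      have h4 := mul_le_mul_of_nonneg_left h3 hE
      linarith
    · refine ⟨P, subset_rfl, by omega, fun S hS => ?_⟩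
      rw [sub_self, abs_zero]
      have : ((T:ℝ) / N) ^ ((1:ℝ) / 4) ≤ 1 := by
        apply Real.rpow_le_one (by positivity) _ (by norm_num)
        rw [div_le_one hN0]; exact_mod_cast hTN
      have : 0 ≤ 1 - ((T:ℝ) / N) ^ ((1:ℝ) / 4) := by linarith
      positivity

lemma exists_log_const (K : ℝ) : ∃ C : ℝ, 3 ≤ C ∧ K * (2 * Real.log (2 * C) + 3) ≤ C := by
  have h1 : Filter.Tendsto (fun x : ℝ => 2 * x) Filter.atTop Filter.atTop :=
    Filter.tendsto_id.const_mul_atTop (by norm_num)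
  have h := (Real.isLittleO_log_id_atTop.comp_tendsto h1).bound (c := 1 / (8 * (|K| + 1))) (by positivity)
  obtain ⟨C, hC, h3, h6⟩ := (h.and ((Filter.eventually_ge_atTop 3).and
    (Filter.eventually_ge_atTop (6 * |K|)))).exists
  refine ⟨C, h3, ?_⟩
  simp only [Function.comp, id, Real.norm_eq_abs] at hC
  have hlog0 : 0 ≤ Real.log (2 * C) := Real.log_nonneg (by linarith)
  rw [abs_of_nonneg hlog0, abs_of_nonneg (by linarith : 0 ≤ 2 * C), div_mul_eq_mul_div,
    le_div_iff₀ (by positivity)] at hC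
  have hK := abs_nonneg K
  calc K * (2 * Real.log (2 * C) + 3) ≤ |K| * (2 * Real.log (2 * C) + 3) :=
        mul_le_mul_of_nonneg_right (le_abs_self K) (by positivity)
    _ ≤ C := by nlinarith

set_option maxHeartbeats 1000000 in
lemma params (κ d v ε C : ℝ) (hκ : 0 < κ) (hd : 1 < d) (hv : 2 ≤ v) (hε0 : 0 < ε) (hε1 : ε < 1)
    (hC3 : 3 ≤ C) (hC : (1568 * κ + 280) * (2 * Real.log (2 * C) + 3) ≤ C) (U : ℝ)
    (hU : U = max ((v * Real.log (v / ε) / ε ^ 2) ^ (d / (d + 1)))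
            (v * (Real.log (v / ε)) ^ ((3 : ℝ) / 2) / ε)) :
    1 ≤ U ∧ ∀ T : ℝ, C * U ≤ T → T ≤ 2 * C * U →
      7 * ((Real.sqrt (8 * v * Real.log T * (κ * T ^ (1 - 1 / d))) + 16 * v * Real.log T) / T) ≤ ε := by
  have hd0 : 0 < d := by linarith
  set z := v / ε with hz
  have hz2 : 2 ≤ z := by rw [hz, le_div_iff₀ hε0]; nlinarith
  set Λ := Real.log z with hΛ
  have hΛ2 : 0.64 ≤ Λ := by
    have := Real.log_le_log (by norm_num) hz2
    linarith [Real.log_two_gt_d9]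
  have hΛz : Λ ≤ z := by
    have := Real.log_le_sub_one_of_pos (show 0 < z by linarith)
    linarith
  have hΛ0 : 0 < Λ := by linarith
  set U1 := (v * Λ / ε ^ 2) ^ (d / (d + 1)) with hU1
  set U2 := v * Λ ^ ((3 : ℝ) / 2) / ε with hU2
  have hΛ32 : 0.8 * Λ ≤ Λ ^ ((3:ℝ) / 2) := by
    have e : Λ ^ ((3:ℝ) / 2) = Λ * Real.sqrt Λ := by
      rw [Real.sqrt_eq_rpow, ← Real.rpow_one_add' hΛ0.le (by norm_num)]; norm_num
    have h1 : 0.8 ≤ Real.sqrt Λ := Real.le_sqrt_of_sq_le (by linarith [hΛ2, (by norm_num : (0.8:ℝ)^2 = 0.64)])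
    rw [e]; nlinarith
  have hU2z : U2 = z * Λ ^ ((3:ℝ) / 2) := by rw [hU2, hz]; ring
  have hUz : 0.8 * z * Λ ≤ U := by
    have : 0.8 * z * Λ ≤ U2 := by rw [hU2z]; nlinarith
    exact this.trans (hU ▸ le_max_right _ _)
  have hU1' : 1 ≤ U := by nlinarith
  refine ⟨hU1', fun T hT1 hT2 => ?_⟩
  have hU0 : 0 < U := by linarith
  have hT3 : 3 ≤ T := by nlinarith
  have hT0 : 0 < T := by linarith
  have hz1 : 1 ≤ z := by linarith
  have hUz3 : U ≤ z ^ 3 := by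
    rw [hU]
    apply max_le
    · have h1 : v * Λ / ε ^ 2 ≤ z ^ 3 := by
        have : v * Λ / ε ^ 2 ≤ v * v * Λ / ε ^ 2 := by
          apply div_le_div_of_nonneg_right _ (by positivity)
          apply mul_le_mul_of_nonneg_right _ hΛ0.le
          nlinarith
        have e : v * v * Λ / ε ^ 2 = z ^ 2 * Λ := by rw [hz]; field_simp
        rw [e] at this
        nlinarith [sq_nonneg z]
      have h2 : 0 ≤ v * Λ / ε ^ 2 := by positivity
      have hexp : d / (d + 1) ≤ 1 := by rw [div_le_one (by linarith)]; linarith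
      calc U1 ≤ (z ^ 3) ^ (d / (d + 1)) := Real.rpow_le_rpow h2 h1 (by positivity)
        _ ≤ (z ^ 3) ^ (1:ℝ) := Real.rpow_le_rpow_of_exponent_le (one_le_pow₀ hz1) hexp
        _ = z ^ 3 := Real.rpow_one _
    · rw [hU2z]
      have : Λ ^ ((3:ℝ) / 2) ≤ z ^ 2 := by
        calc Λ ^ ((3:ℝ) / 2) ≤ z ^ ((3:ℝ) / 2) := Real.rpow_le_rpow hΛ0.le hΛz (by norm_num)
          _ ≤ z ^ (2:ℝ) := Real.rpow_le_rpow_of_exponent_le hz1 (by norm_num)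
          _ = z ^ 2 := by norm_num
      nlinarith
  set C3 := 2 * Real.log (2 * C) + 3 with hC3'
  have hlogC : 0 ≤ Real.log (2 * C) := Real.log_nonneg (by linarith)
  have hLT : Real.log T ≤ C3 * Λ := by
    have h1 : Real.log T ≤ Real.log (2 * C * z ^ 3) :=
      Real.log_le_log hT0 (hT2.trans (mul_le_mul_of_nonneg_left hUz3 (by linarith)))
    rw [Real.log_mul (by linarith) (by positivity), Real.log_pow] at h1
    push_cast at h1
    rw [hC3']; nlinarith
  have hLT0 : 0 ≤ Real.log T := Real.log_nonneg (by linarith)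
  have hC30 : 0 < C3 := by linarith
  have hb1 : 1568 * κ * C3 ≤ C := by nlinarith
  have hb2 : 280 * C3 ≤ C := by nlinarith [mul_pos hκ hC30]
  have hC0 : 0 < C := by linarith
  -- second term
  have hsec : 16 * v * Real.log T / T ≤ ε / 14 := by
    rw [div_le_iff₀ hT0]
    have h1 : v = z * ε := by rw [hz]; field_simp
    have h2 : 16 * v * Real.log T ≤ 16 * v * (C3 * Λ) := by gcongr
    have h3 : C * (0.8 * z * Λ) ≤ T := (mul_le_mul_of_nonneg_left hUz hC0.le).trans hT1
    have h4 : 280 * C3 * (0.8 * z * Λ) ≤ T := (mul_le_mul_of_nonneg_right hb2 (by positivity)).trans h3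
    have h5 := mul_le_mul_of_nonneg_left h4 hε0.le
    rw [h1] at h2 ⊢
    nlinarith
  have hUd : v * Λ / ε ^ 2 ≤ U ^ ((d + 1) / d) := by
    have h1 : U1 ≤ U := hU ▸ le_max_left _ _
    have h2 : U1 ^ ((d + 1) / d) = v * Λ / ε ^ 2 := by
      rw [hU1, ← Real.rpow_mul (by positivity), show d / (d + 1) * ((d + 1) / d) = 1 by field_simp,
        Real.rpow_one]
    rw [← h2]
    exact Real.rpow_le_rpow (by positivity) h1 (by positivity)
  have hexp1 : 1 ≤ (d + 1) / d := by rw [le_div_iff₀ hd0]; linarith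
  have hTd : C * (v * Λ / ε ^ 2) ≤ T ^ ((d + 1) / d) := by
    calc C * (v * Λ / ε ^ 2) ≤ C ^ ((d + 1) / d) * U ^ ((d + 1) / d) := by
          refine mul_le_mul ?_ hUd (by positivity) (by positivity)
          calc C = C ^ (1:ℝ) := (Real.rpow_one C).symm
            _ ≤ _ := Real.rpow_le_rpow_of_exponent_le (by linarith) hexp1
      _ = (C * U) ^ ((d + 1) / d) := (Real.mul_rpow hC0.le hU0.le).symm
      _ ≤ _ := Real.rpow_le_rpow (by positivity) hT1 (by positivity)
  have hTT : T ^ (1 - 1 / d) * T ^ ((d + 1) / d) = T ^ 2 := by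
    rw [← Real.rpow_add hT0, ← Real.rpow_natCast]
    congr 1
    have : (d + 1) / d = 1 + 1 / d := by field_simp
    rw [this]
    push_cast
    ring
  have hfirst : Real.sqrt (8 * v * Real.log T * (κ * T ^ (1 - 1 / d))) / T ≤ ε / 14 := by
    rw [div_le_iff₀ hT0]
    apply Real.sqrt_le_iff.2 ⟨by positivity, ?_⟩
    have h1 : 8 * v * Real.log T * (κ * T ^ (1 - 1 / d)) ≤
        8 * v * (C3 * Λ) * (κ * T ^ (1 - 1 / d)) := by gcongr
    refine h1.trans ?_
    rw [mul_pow, ← hTT]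
    have hθ : 0 < T ^ (1 - 1 / d) := Real.rpow_pos_of_pos hT0 _
    have h2 : C * (v * Λ) ≤ ε ^ 2 * T ^ ((d + 1) / d) := by
      rw [mul_div_assoc', div_le_iff₀ (by positivity)] at hTd
      linarith
    have h3 : 1568 * κ * C3 * (v * Λ) ≤ ε ^ 2 * T ^ ((d + 1) / d) :=
      (mul_le_mul_of_nonneg_right hb1 (by positivity)).trans h2
    have h4 := mul_le_mul_of_nonneg_right h3 hθ.le
    nlinarith
  rw [add_div]
  linarith

/-- existence form of Corollary 1.3. For constants `c > 0`, `d > 1` there is a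
constant `C = C(c,d)` such that: any finite set system with `n ≥ 2`, `m ≥ 34`, `m ≥ n`,
`X ∈ 𝒮`, dual shatter function at most `c·k^d` and VC-dimension `dvc ≥ 2` admits, for every
`ε ∈ (0,1)`, an `ε`-approximation `A ⊆ X` of size at most
`C·max{(dvc·ln(dvc/ε)/ε²)^{d/(d+1)}, dvc·(ln(dvc/ε))^{3/2}/ε}`. -/
theorem stmt_19 (c d : ℝ) (hc : 0 < c) (hd : 1 < d) :
    ∃ C : ℝ, ∀ (V : Type) [DecidableEq V], ∀ (X : Finset V) (𝒮 : Finset (Finset V)),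
      (∀ S ∈ 𝒮, S ⊆ X) → 2 ≤ X.card → 34 ≤ 𝒮.card → X.card ≤ 𝒮.card → X ∈ 𝒮 →
      (∀ R ⊆ 𝒮, R.Nonempty →
        ((X.image fun x => R.filter fun r => x ∈ r).card : ℝ) ≤ c * (R.card : ℝ) ^ d) →
      ∀ dvc : ℕ, 2 ≤ dvc →
      (∃ Y ⊆ X, Y.card = dvc ∧ ∀ Z ⊆ Y, ∃ S ∈ 𝒮, S ∩ Y = Z) →
      (∀ Y ⊆ X, (∀ Z ⊆ Y, ∃ S ∈ 𝒮, S ∩ Y = Z) → Y.card ≤ dvc) →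
      ∀ ε : ℝ, 0 < ε → ε < 1 →
      ∃ A ⊆ X,
        (A.card : ℝ) ≤ C * max (((dvc : ℝ) * Real.log ((dvc : ℝ) / ε) / ε ^ 2) ^ (d / (d + 1)))
            ((dvc : ℝ) * (Real.log ((dvc : ℝ) / ε)) ^ ((3 : ℝ) / 2) / ε) ∧
        ∀ S ∈ 𝒮, |(S.card : ℝ) / X.card - ((A ∩ S).card : ℝ) / A.card| ≤ ε := by
  obtain ⟨κ, hκ, hhalf⟩ := halving c d hc hd
  obtain ⟨C, hC3, hC⟩ := exists_log_const (1568 * κ + 280)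
  refine ⟨4 * C, ?_⟩
  intro V _ X 𝒮 hsub hX2 _ _ _ hdual dvc hdvc _ hvc ε hε0 hε1
  have hd0 : 0 < d := by linarith
  have hθ0 : 0 < 1 - 1 / d := by
    have : 1 / d < 1 := by rw [div_lt_one hd0]; exact hd
    linarith
  have hθ1 : 1 - 1 / d < 1 := by
    have : 0 < 1 / d := by positivity
    linarith
  generalize hU : max (((dvc : ℝ) * Real.log ((dvc : ℝ) / ε) / ε ^ 2) ^ (d / (d + 1)))
            ((dvc : ℝ) * (Real.log ((dvc : ℝ) / ε)) ^ ((3 : ℝ) / 2) / ε) = U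
  obtain ⟨hU1, hpar⟩ := params κ d dvc ε C hκ hd (by exact_mod_cast hdvc) hε0 hε1 hC3 hC U hU.symm
  have hCU : 3 ≤ C * U := by nlinarith
  set T := ⌈C * U⌉₊ with hT
  have hT1 : C * U ≤ T := Nat.le_ceil _
  have hT2 : (T:ℝ) ≤ 2 * C * U := by
    have := Nat.ceil_lt_add_one (show 0 ≤ C * U by linarith)
    rw [← hT] at this
    linarith
  have hT3 : 3 ≤ T := by
    have : (3:ℝ) ≤ T := hCU.trans hT1
    exact_mod_cast this
  have hXS : ∀ S ∈ 𝒮, X ∩ S = S := fun S hS => inter_eq_right.2 (hsub S hS)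
  by_cases hbig : T ≤ X.card
  · set E := (Real.sqrt (8 * dvc * Real.log T * (κ * (T:ℝ) ^ (1 - 1 / d))) + 16 * dvc * Real.log T) / T
      with hE
    have hT3R : (3:ℝ) ≤ T := by exact_mod_cast hT3
    have hlogT : 0 ≤ Real.log T := Real.log_nonneg (by linarith)
    have hE0 : 0 ≤ E := by positivity
    obtain ⟨A, hA, hAc, hAe⟩ := iterate X 𝒮 T hT3 E hE0 (by
      intro P hP q r hq hr hPc
      obtain ⟨Q, hQ, hQc, hQe⟩ := hhalf V X 𝒮 hdual dvc hdvc hvc P hP q r (by omega) hr hPc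
      refine ⟨Q, hQ, hQc, fun S hS => (hQe S hS).trans ?_⟩
      exact decay T q dvc κ (1 - 1 / d) hT3R (by exact_mod_cast hq) (by positivity) hκ hθ0 hθ1)
      X.card X subset_rfl rfl hbig
    refine ⟨A, hA, ?_, fun S hS => ?_⟩
    · have : (A.card : ℝ) ≤ 2 * T := by exact_mod_cast hAc
      linarith
    · have h1 := hAe S hS
      rw [hXS S hS] at h1
      refine h1.trans ?_
      have h2 := hpar T hT1 hT2
      have h3 : 0 ≤ ((T:ℝ) / X.card) ^ ((1:ℝ) / 4) := by positivity
      rw [← hE] at h2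
      nlinarith [mul_nonneg hE0 h3]
  · refine ⟨X, subset_rfl, ?_, fun S hS => ?_⟩
    · have : (X.card : ℝ) ≤ T := by exact_mod_cast (by omega : X.card ≤ T)
      nlinarith
    · rw [hXS S hS]; simp [hε0.le]
end
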